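/- Let A be an affine algebra of Krull dimension d ≥ 4 over the algebraic closure of a finite prime field 𝔽_p. Assume that for every finite ring extension R of A (a ring extension A ⊆ R with R finitely generated as an A-module), the free R-module of rank d − 1 is cancellative. Then every finitely generated projective A-module of rank d − 1 is cancellative. -/

import Mathlib

/-- A module `P` over `A` is *cancellative* if `P ⊕ Aᵐ ≅ Q ⊕ Aᵐ` implies `P ≅ Q`
for every finitely generated projective `A`-module `Q` and every `m ≥ 0`. -/
def IsCancellative (A : Type) [CommRing A] (P : Type) [AddCommGroup P] [Module A P] : Prop :=
  ∀ (Q : Type) [AddCommGroup Q] [Module A Q], Module.Finite A Q → Module.Projective A Q →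
    ∀ m : ℕ, Nonempty ((P × (Fin m → A)) ≃ₗ[A] (Q × (Fin m → A))) → Nonempty (P ≃ₗ[A] Q)

/-- A module has rank `n` if its localization at every prime ideal is of rank `n`. -/
def HasRank (A : Type) [CommRing A] (P : Type) [AddCommGroup P] [Module A P] (n : ℕ) : Prop :=
  ∀ p : PrimeSpectrum A, Module.rankAtStalk P p = n

section Elementary

variable {R S ι κ : Type*} [CommRing R] [CommRing S] [DecidableEq ι] [DecidableEq κ]

/-- Adding a multiple of one coordinate to another coordinate. -/
def ElemStep (v w : ι → R) : Prop :=
  ∃ i j : ι, ∃ t : R, i ≠ j ∧ w = Function.update v i (v i + t * v j)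

/-- Two rows are elementarily equivalent if they differ by a sequence of elementary operations. -/
def Elem (v w : ι → R) : Prop := Relation.ReflTransGen ElemStep v w

theorem ElemStep.symm {v w : ι → R} (h : ElemStep v w) : ElemStep w v := by
  obtain ⟨i, j, t, hij, rfl⟩ := h
  refine ⟨i, j, -t, hij, ?_⟩
  ext l
  by_cases hl : l = i
  · subst hl; simp [Function.update_of_ne hij.symm]
  · simp [Function.update_of_ne hl]

theorem Elem.refl (v : ι → R) : Elem v v := Relation.ReflTransGen.refl

theorem Elem.trans {u v w : ι → R} (h : Elem u v) (h' : Elem v w) : Elem u w :=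
  Relation.ReflTransGen.trans h h'

theorem Elem.symm {v w : ι → R} (h : Elem v w) : Elem w v := by
  induction h with
  | refl => exact .refl _
  | tail _ hs ih => exact (Relation.ReflTransGen.single hs.symm).trans ih

theorem Elem.of_update {v : ι → R} {i j : ι} (hij : i ≠ j) (t : R) :
    Elem v (Function.update v i (v i + t * v j)) :=
  Relation.ReflTransGen.single ⟨i, j, t, hij, rfl⟩

theorem Elem.exists_lift (f : R →+* S) (hf : Function.Surjective f) {v : ι → R} {w : ι → S}
    (h : Elem (f ∘ v) w) : ∃ v', Elem v v' ∧ f ∘ v' = w := by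
  induction h with
  | refl => exact ⟨v, .refl _, rfl⟩
  | tail _ hs ih =>
    obtain ⟨v', hv', rfl⟩ := ih
    obtain ⟨i, j, t, hij, rfl⟩ := hs
    obtain ⟨t, rfl⟩ := hf t
    refine ⟨_, hv'.trans (.of_update hij t), ?_⟩
    rw [Function.comp_update]
    simp

theorem Elem.reindex (e : ι ≃ κ) {v w : κ → R} (h : Elem (v ∘ e) (w ∘ e)) : Elem v w := by
  have key : ∀ a b : ι → R, Elem a b → Elem (a ∘ e.symm) (b ∘ e.symm) := by
    intro a b h
    induction h with
    | refl => exact .refl _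
    | tail _ hs ih =>
      obtain ⟨i, j, t, hij, rfl⟩ := hs
      refine ih.trans ?_
      rename_i b' _
      have := Elem.of_update (v := b' ∘ e.symm) (i := e i) (j := e j) (by simpa using hij) t
      convert this using 1
      ext l
      by_cases hl : l = e i
      · subst hl; simp
      · have : e.symm l ≠ i := fun h => hl (by simp [← h])
        simp [Function.update_of_ne hl, Function.update_of_ne this]
  have := key _ _ h
  simpa [Function.comp_assoc] using this

theorem Elem.span_eq {v w : ι → R} (h : Elem v w) :
    Ideal.span (Set.range v) = Ideal.span (Set.range w) := by
  have key : ∀ a b : ι → R, ElemStep a b →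
      Ideal.span (Set.range b) ≤ Ideal.span (Set.range a) := by
    rintro a b ⟨i, j, t, hij, rfl⟩
    rw [Ideal.span_le]
    rintro _ ⟨l, rfl⟩
    by_cases hl : l = i
    · subst hl
      simp only [Function.update_self, SetLike.mem_coe]
      exact Ideal.add_mem _ (Ideal.subset_span ⟨_, rfl⟩)
        (Ideal.mul_mem_left _ _ (Ideal.subset_span ⟨_, rfl⟩))
    · simp only [Function.update_of_ne hl]
      exact Ideal.subset_span ⟨_, rfl⟩
  induction h with
  | refl => rfl
  | tail _ hs ih => exact ih.trans (le_antisymm (key _ _ hs.symm) (key _ _ hs))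

theorem Elem.exists_linearEquiv {v w : ι → R} (h : Elem v w) :
    ∃ M : (ι → R) ≃ₗ[R] (ι → R), M v = w := by
  induction h with
  | refl => exact ⟨LinearEquiv.refl _ _, rfl⟩
  | tail _ hs ih =>
    obtain ⟨M, hM⟩ := ih
    obtain ⟨i, j, t, hij, rfl⟩ := hs
    let f : R → (ι → R) →ₗ[R] (ι → R) := fun t =>
      LinearMap.id + t • (LinearMap.single R (fun _ => R) i ∘ₗ LinearMap.proj j)
    have hf : ∀ t, f t ∘ₗ f (-t) = LinearMap.id := by
      intro t
      ext a l
      simp only [f, LinearMap.comp_apply, LinearMap.add_apply, LinearMap.id_apply,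
        LinearMap.smul_apply, LinearMap.proj_apply, LinearMap.single_apply, Pi.add_apply,
        Pi.smul_apply, smul_eq_mul, Pi.single_apply]
      split_ifs <;> simp_all
    let N : (ι → R) ≃ₗ[R] (ι → R) :=
      LinearEquiv.ofLinearMap (f t) (f (-t)) (hf t) (by simpa using hf (-t))
    refine ⟨M.trans N, ?_⟩
    ext l
    change f t (M v) l = _
    simp only [hM, f, LinearMap.add_apply, LinearMap.id_apply, LinearMap.smul_apply, LinearMap.comp_apply, LinearMap.proj_apply,
      LinearMap.single_apply, Pi.add_apply, Pi.smul_apply, Pi.single_apply, Function.update_apply]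
    split_ifs with h
    · subst h; simp
    · simp

/-- Adding a linear combination of the other coordinates. -/
theorem Elem.update_add_sum (v t : ι → R) (i : ι) (s : Finset ι) (hi : i ∉ s) :
    Elem v (Function.update v i (v i + ∑ j ∈ s, t j * v j)) := by
  induction s using Finset.induction_on with
  | empty => simpa using Elem.refl v
  | insert j s hj ih =>
    have hij : i ≠ j := fun h => hi (by simp [h])
    refine (ih fun h => hi (by simp [h])).trans ?_
    have := Elem.of_update (v := Function.update v i (v i + ∑ j ∈ s, t j * v j)) hij (t j)
    convert this using 1
    simp [Function.update_of_ne hij.symm, Finset.sum_insert hj]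
    congr 1
    ring

/-- Adding multiples of one coordinate to all the other ones. -/
theorem Elem.add_mul_coord [Fintype ι] (v t : ι → R) (i : ι) (ht : t i = 0) :
    Elem v (fun j => v j + t j * v i) := by
  have key : ∀ s : Finset ι, i ∉ s → Elem v (fun j => if j ∈ s then v j + t j * v i else v j) := by
    intro s
    induction s using Finset.induction_on with
    | empty => intro _; simpa using Elem.refl v
    | insert j s hj ih =>
      intro hi
      have hij : j ≠ i := fun h => hi (by simp [h])
      have his : i ∉ s := fun h => hi (by simp [h])
      refine (ih his).trans ?_
      have := Elem.of_update (v := fun j => if j ∈ s then v j + t j * v i else v j) hij (t j)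
      convert this using 1
      ext l
      by_cases hl : l = j
      · subst hl; simp [hj, his]
      · simp [hl]
  convert key (Finset.univ.erase i) (by simp) using 1
  ext j
  by_cases h : j = i
  · subst h; simp [ht]
  · simp [h]

/-- A row with an entry equal to one is equivalent to any basis vector. -/
theorem Elem.of_eq_one [Fintype ι] {v : ι → R} {i : ι} (hv : v i = 1) (k : ι) :
    Elem v (Pi.single k 1) := by
  have h1 : ∀ (v : ι → R) (i : ι), v i = 1 → Elem v (Pi.single i 1) := by
    intro v i hv
    have := Elem.add_mul_coord v (fun j => if j = i then 0 else - v j) i (by simp)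
    convert this using 1
    ext j
    by_cases h : j = i
    · subst h; simp [hv]
    · simp [h, hv]
  refine (h1 v i hv).trans ?_
  by_cases hik : i = k
  · subst hik; exact .refl _
  have := Elem.of_update (v := Pi.single i (1 : R)) (Ne.symm hik) 1
  refine this.trans (h1 _ _ ?_)
  simp [Ne.symm hik]

/-- A row of which a part is unimodular is completely reducible. -/
theorem Elem.of_span_eq_top [Fintype ι] {v : ι → R} {i : ι}
    (hv : Ideal.span (v '' {j | j ≠ i}) = ⊤) (k : ι) : Elem v (Pi.single k 1) := by
  have h1 : (1 : R) - v i ∈ Ideal.span (v '' {j | j ≠ i}) := by rw [hv]; trivial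
  have : v '' {j | j ≠ i} = Set.range (fun j : {j // j ≠ i} => v j) := by
    ext; simp
  rw [this, Ideal.mem_span_range_iff_exists_fun] at h1
  obtain ⟨c, hc⟩ := h1
  have := Elem.update_add_sum v (fun j => if h : j ≠ i then c ⟨j, h⟩ else 0) i
    (Finset.univ.erase i) (by simp)
  refine this.trans (Elem.of_eq_one (i := i) ?_ k)
  rw [Function.update_self]
  have : ∑ j ∈ Finset.univ.erase i, (if h : j ≠ i then c ⟨j, h⟩ else 0) * v j = 1 - v i := by
    rw [← hc, Finset.sum_subtype (Finset.univ.erase i) (p := fun j => j ≠ i) (by simp)]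
    refine Finset.sum_congr rfl fun j _ => ?_
    rw [dif_pos j.2]
  rw [this]; ring

theorem Elem.cons {n : ℕ} {v w : Fin n → R} (c : R) (h : Elem v w) :
    Elem (Fin.cons c v : Fin (n + 1) → R) (Fin.cons c w) := by
  induction h with
  | refl => exact .refl _
  | tail _ hs ih =>
    obtain ⟨i, j, t, hij, rfl⟩ := hs
    rename_i b' _
    refine ih.trans ?_
    rw [Fin.cons_update]
    have := Elem.of_update (v := (Fin.cons c b' : Fin (n + 1) → R)) (i := i.succ) (j := j.succ)
      (by simpa using hij) t
    simpa using this

theorem Elem.cons_of_dvd {n : ℕ} {v w : Fin n → R} {c : R} (h : ∀ i, c ∣ w i - v i) :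
    Elem (Fin.cons c v : Fin (n + 1) → R) (Fin.cons c w) := by
  choose t ht using h
  have := Elem.add_mul_coord (Fin.cons c v : Fin (n + 1) → R) (Fin.cons 0 t) 0 (by simp)
  convert this using 1
  ext j
  refine Fin.cases ?_ (fun i => ?_) j
  · simp
  · simp only [Fin.cons_succ, Fin.cons_zero]
    linear_combination ht i

/-- Equivalence of the tails modulo the first entry suffices. -/
theorem Elem.cons_of_quotient {n : ℕ} {v w : Fin n → R} {c : R}
    (h : Elem (Ideal.Quotient.mk (Ideal.span {c}) ∘ v) (Ideal.Quotient.mk (Ideal.span {c}) ∘ w)) :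
    Elem (Fin.cons c v : Fin (n + 1) → R) (Fin.cons c w) := by
  obtain ⟨v', h1, h2⟩ := h.exists_lift _ Ideal.Quotient.mk_surjective
  refine (h1.cons c).trans (Elem.cons_of_dvd fun i => ?_)
  have := congrFun h2 i
  simp only [Function.comp_apply] at this
  rw [eq_comm, Ideal.Quotient.mk_eq_mk_iff_sub_mem, Ideal.mem_span_singleton] at this
  exact this

theorem Elem.of_pair {a b a' b' : R} (h : a' = a) (t : R) (h' : b' = b + t * a) :
    Elem ![a, b] ![a', b'] := by
  subst h h'
  have := Elem.of_update (v := ![a', b]) (i := 1) (j := 0) (by simp) t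
  convert this using 1
  ext i; fin_cases i <;> simp

theorem Elem.of_pair' {a b a' b' : R} (h : b' = b) (t : R) (h' : a' = a + t * b) :
    Elem ![a, b] ![a', b'] := by
  subst h h'
  have := Elem.of_update (v := ![a, b']) (i := 0) (j := 1) (by simp) t
  convert this using 1
  ext i; fin_cases i <;> simp

theorem Elem.swap_neg (a b : R) (t s : R) (h : t * s = 1) :
    Elem ![a, b] ![t * b, - s * a] := by
  have h1 : Elem ![a, b] ![a + t * b, b] := .of_pair' rfl t rfl
  have h2 : Elem ![a + t * b, b] ![a + t * b, - s * a] :=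
    .of_pair rfl (-s) (by linear_combination b * h)
  have h3 : Elem ![a + t * b, - s * a] ![t * b, - s * a] :=
    .of_pair' rfl t (by linear_combination a * h)
  exact h1.trans (h2.trans h3)

theorem Elem.diag (a b : R) (t s : R) (h : t * s = 1) : Elem ![a, b] ![t * a, s * b] := by
  have h1 := Elem.swap_neg a b 1 1 (by ring)
  have h2 := Elem.swap_neg (1 * b) (-1 * a) (-t) (-s) (by linear_combination h)
  have e1 : -t * (-1 * a) = t * a := by ring
  have e2 : - -s * (1 * b) = s * b := by ring
  rw [e1, e2] at h2
  exact h1.trans h2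

/-- Coprime pairs which are congruent modulo the nilradical are equivalent. -/
theorem Elem.of_isNilpotent {x y x' y' : R} (h : IsCoprime x y) (hx : IsNilpotent (x' - x))
    (hy : IsNilpotent (y' - y)) : Elem ![x, y] ![x', y'] := by
  obtain ⟨u, w, huw⟩ := h
  -- `u x' + w y'` is a unit
  have hn : IsNilpotent (u * (x' - x) + w * (y' - y)) :=
    (nilradical R).add_mem ((nilradical R).mul_mem_left _ hx) ((nilradical R).mul_mem_left _ hy)
  have hε : IsUnit (u * x' + w * y') := by
    have := hn.isUnit_one_add
    convert this using 1
    linear_combination huw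
  obtain ⟨ε, hε⟩ := hε
  set e : R := ((ε⁻¹ : Rˣ) : R)
  have hee : e * (u * x' + w * y') = 1 := by rw [← hε]; simp [e]
  have h1e : IsNilpotent (e - 1) := by
    have : e - 1 = - e * (u * (x' - x) + w * (y' - y)) := by
      linear_combination hee - e * huw
    rw [this]
    exact (nilradical R).mul_mem_left _ hn
  -- the matrix taking `(x, y)` to `(x', y')`
  set P := x' * u + e * w * y with hP
  set q := x' * w - e * w * x with hq
  set r := y' * u - e * u * y with hr
  set s := y' * w + e * u * x with hs
  have hPx : P * x + q * y = x' := by rw [hP, hq]; linear_combination x' * huw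
  have hrx : r * x + s * y = y' := by rw [hr, hs]; linear_combination y' * huw
  have hdet : P * s - q * r = 1 := by
    rw [hP, hq, hr, hs]; linear_combination (e * (u * x' + w * y')) * huw + hee
  have hPu : IsUnit P := by
    have : IsNilpotent (P - 1) := by
      have : P - 1 = u * (x' - x) + w * y * (e - 1) := by rw [hP]; linear_combination huw
      rw [this]
      exact (nilradical R).add_mem ((nilradical R).mul_mem_left _ hx)
        ((nilradical R).mul_mem_left _ h1e)
    simpa using this.isUnit_one_add
  obtain ⟨p, hp⟩ := hPu
  set i : R := ((p⁻¹ : Rˣ) : R)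
  have hpi : P * i = 1 := by rw [← hp]; simp [i]
  have s1 : Elem ![x, y] ![x + (i * q) * y, y] := .of_pair' rfl (i * q) rfl
  have s2 := Elem.diag (x + (i * q) * y) y P i hpi
  have s3 : Elem ![P * (x + (i * q) * y), i * y] ![x', y'] :=
    .of_pair (by rw [← hPx]; linear_combination -(q * y) * hpi) (i * r) (by
      rw [← hrx]
      linear_combination (-(r * x) - s * y - i * r * q * y) * hpi + y * i * hdet)
  exact s1.trans (s2.trans s3)

theorem Elem.of_mem_radical {c x y x' y' : R} (h : Ideal.span {c, x, y} = ⊤)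
    (hx : x' - x ∈ (Ideal.span {c}).radical) (hy : y' - y ∈ (Ideal.span {c}).radical) :
    Elem ![c, x, y] ![c, x', y'] := by
  refine Elem.cons_of_quotient ?_
  have hn : ∀ a b : R, a - b ∈ (Ideal.span {c}).radical →
      IsNilpotent (Ideal.Quotient.mk (Ideal.span {c}) a - Ideal.Quotient.mk (Ideal.span {c}) b) := by
    rintro a b ⟨n, hn⟩
    exact ⟨n, by rw [← map_sub, ← map_pow, Ideal.Quotient.eq_zero_iff_mem]; exact hn⟩
  have h2 : IsCoprime (Ideal.Quotient.mk (Ideal.span {c}) x) (Ideal.Quotient.mk (Ideal.span {c}) y) := by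
    have h1 : (1 : R) ∈ Ideal.span {c, x, y} := by rw [h]; trivial
    rw [Ideal.mem_span_insert] at h1
    obtain ⟨a, z, hz, e⟩ := h1
    obtain ⟨b, d, rfl⟩ := Ideal.mem_span_pair.1 hz
    refine ⟨Ideal.Quotient.mk _ b, Ideal.Quotient.mk _ d, ?_⟩
    rw [← map_mul, ← map_mul, ← map_add, ← map_one (Ideal.Quotient.mk _),
      Ideal.Quotient.mk_eq_mk_iff_sub_mem, Ideal.mem_span_singleton]
    exact ⟨-a, by linear_combination -e⟩
  have := Elem.of_isNilpotent h2 (hn _ _ hx) (hn _ _ hy)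
  convert this using 1 <;> (ext i; fin_cases i <;> rfl)

end Elementary

section PowerLemma

variable {R : Type*} [CommRing R]

theorem Ideal.span_eq_top_of_subset_radical {s : Set R} {I : Ideal R} (hs : Ideal.span s = ⊤)
    (h : s ⊆ I.radical) : I = ⊤ := by
  rw [← Ideal.radical_eq_top, eq_top_iff, ← hs, Ideal.span_le]
  exact h

theorem Elem.rotate {a b c a' b' c' : R} (h : Elem ![c, a, b] ![c', a', b']) :
    Elem ![a, b, c] ![a', b', c'] := by
  refine Elem.reindex (finRotate 3).symm ?_
  convert h using 1 <;> (ext i; fin_cases i <;> rfl)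

/-- An exponent can be moved from the last entry to the second one. -/
theorem Elem.pow_swap {c x z : R} (h : Ideal.span {c, x, z} = ⊤) (N : ℕ) :
    Elem ![c, x, z ^ N] ![c, x ^ N, z] := by
  have s1 : Elem ![c, x, z ^ N] ![c, x - z, z ^ N] := by
    refine Elem.rotate (Elem.of_mem_radical ?_ (by simp) ?_)
    · refine Ideal.span_eq_top_of_subset_radical h ?_
      rintro a (rfl | rfl | rfl)
      · exact Ideal.le_radical (Ideal.subset_span (by simp))
      · exact Ideal.le_radical (Ideal.subset_span (by simp))
      · exact ⟨N, Ideal.subset_span (by simp)⟩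
    · have : z ∈ (Ideal.span {z ^ N}).radical := ⟨N, Ideal.subset_span (by simp)⟩
      rw [sub_sub_cancel_left]
      exact neg_mem this
  have s2 : Elem ![c, x - z, z ^ N] ![c, x - z, x ^ N] := by
    refine Elem.cons c ?_
    obtain ⟨t, ht⟩ := sub_dvd_pow_sub_pow x z N
    exact Elem.of_pair rfl t (by linear_combination ht)
  have s3 : Elem ![c, x - z, x ^ N] ![c, -z, x ^ N] := by
    refine Elem.rotate (Elem.of_mem_radical ?_ (by simp) ?_)
    · refine Ideal.span_eq_top_of_subset_radical h ?_
      have hx : x ∈ (Ideal.span {x ^ N, c, x - z}).radical := ⟨N, Ideal.subset_span (by simp)⟩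
      rintro a (rfl | rfl | rfl)
      · exact Ideal.le_radical (Ideal.subset_span (by simp))
      · exact hx
      · have : x - a ∈ (Ideal.span {x ^ N, c, x - a}).radical :=
          Ideal.le_radical (Ideal.subset_span (by simp))
        simpa using sub_mem hx this
    · have : x ∈ (Ideal.span {x ^ N}).radical := ⟨N, Ideal.subset_span (by simp)⟩
      have e : -z - (x - z) = -x := by ring
      rw [e]
      exact neg_mem this
  have s4 : Elem ![c, -z, x ^ N] ![c, x ^ N, z] := by
    refine Elem.cons c ?_
    have := Elem.swap_neg (-z) (x ^ N) 1 1 (by ring)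
    simpa using this
  exact s1.trans (s2.trans (s3.trans s4))

end PowerLemma

section Lifting

variable {R C : Type*} [CommRing R] [CommRing C]

/-- If `f ^ M - 1` is divisible by `a`, then so is `f ^ (M * N) - 1`. -/
theorem dvd_pow_mul_sub_one {a f : R} {M : ℕ} (h : a ∣ f ^ M - 1) (N : ℕ) :
    a ∣ f ^ (M * N) - 1 :=
  h.trans (by rw [pow_mul]; simpa using sub_dvd_pow_sub_pow (f ^ M) 1 N)

theorem exists_common_pow {ι : Type*} (s : Finset ι) {P : ι → ℕ → Prop}
    (h : ∀ i ∈ s, ∃ M, M ≠ 0 ∧ P i M) (hmul : ∀ i M N, N ≠ 0 → P i M → P i (M * N)) :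
    ∃ M, M ≠ 0 ∧ ∀ i ∈ s, P i M := by
  classical
  induction s using Finset.induction_on with
  | empty => exact ⟨1, one_ne_zero, by simp⟩
  | insert j s hj ih =>
    obtain ⟨M, hM, h1⟩ := ih fun i hi => h i (by simp [hi])
    obtain ⟨N, hN, h2⟩ := h j (by simp)
    refine ⟨M * N, mul_ne_zero hM hN, fun i hi => ?_⟩
    rcases Finset.mem_insert.1 hi with rfl | hi
    · rw [mul_comm]; exact hmul _ _ _ hM h2
    · exact hmul _ _ _ hN (h1 i hi)

/-- Lifting pairwise coprime elements, up to powers. -/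
theorem exists_lift_pairwise_isCoprime {ι : Type*} (π : R →+* C) (hπ : Function.Surjective π)
    (f : ι → C) (s : Finset ι)
    (hf : ∀ i ∈ s, ∀ j ∈ s, i ≠ j → ∀ Q : ℕ, ∃ M, M ≠ 0 ∧ f j ^ Q ∣ f i ^ M - 1) :
    ∃ Q, Q ≠ 0 ∧ ∃ F : ι → R, (∀ i ∈ s, π (F i) = f i ^ Q) ∧
      ∀ i ∈ s, ∀ j ∈ s, i ≠ j → IsCoprime (F i) (F j) := by
  classical
  induction s using Finset.induction_on with
  | empty => exact ⟨1, one_ne_zero, fun _ => 0, by simp, by simp⟩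
  | insert i s hi ih =>
    obtain ⟨Q, hQ, F, h1, h2⟩ := ih fun a ha b hb => hf a (by simp [ha]) b (by simp [hb])
    obtain ⟨M, hM, h3⟩ := exists_common_pow s (P := fun j M => f j ^ Q ∣ f i ^ M - 1)
      (fun j hj => hf i (by simp) j (by simp [hj]) (by rintro rfl; exact hi hj) Q)
      (fun j M N _ h => dvd_pow_mul_sub_one h N)
    have h4 : ∏ j ∈ s, f j ^ Q ∣ f i ^ (M * Q) - 1 := by
      refine Finset.prod_dvd_of_coprime ?_ fun j hj => dvd_pow_mul_sub_one (h3 j hj) Q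
      intro a ha b hb hab
      have := h2 a ha b hb hab
      have := this.map π
      rw [h1 a ha, h1 b hb] at this
      exact this
    obtain ⟨H, hH⟩ := h4
    obtain ⟨H, rfl⟩ := hπ H
    refine ⟨Q * M, mul_ne_zero hQ hM,
      fun j => if j = i then 1 + (∏ j ∈ s, F j) * H else F j ^ M, ?_, ?_⟩
    · intro j hj
      by_cases hji : j = i
      · subst hji
        simp only [if_true, map_add, map_one, map_mul, map_prod]
        rw [Finset.prod_congr rfl h1, ← hH, mul_comm Q M]; ring
      · simp only [if_neg hji, map_pow]
        rw [h1 j ((Finset.mem_insert.1 hj).resolve_left hji), pow_mul]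
    · have key : ∀ j ∈ s, IsCoprime (1 + (∏ j ∈ s, F j) * H) (F j ^ M) := by
        intro j hj
        refine IsCoprime.pow_right ?_
        obtain ⟨t, ht⟩ := Finset.dvd_prod_of_mem F hj
        refine ⟨1, - (t * H), ?_⟩
        rw [ht]; ring
      intro a ha b hb hab
      by_cases hai : a = i
      · subst hai
        have hb' := (Finset.mem_insert.1 hb).resolve_left (Ne.symm hab)
        simp only [if_true, if_neg (Ne.symm hab)]
        exact key b hb'
      · have ha' := (Finset.mem_insert.1 ha).resolve_left hai
        by_cases hbi : b = i
        · subst hbi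
          simp only [if_true, if_neg hai]
          exact (key a ha').symm
        · have hb' := (Finset.mem_insert.1 hb).resolve_left hbi
          simp only [if_neg hai, if_neg hbi]
          exact (h2 a ha' b hb' hab).pow

end Lifting

section Dimension

variable {R : Type*} [CommRing R]

theorem Ring.KrullDimLE.quotient {n : ℕ} [h : Ring.KrullDimLE n R] (I : Ideal R) :
    Ring.KrullDimLE n (R ⧸ I) := by
  rw [Ring.krullDimLE_iff] at h ⊢
  exact (ringKrullDim_quotient_le I).trans h

/-- The dimension drops modulo an ideal contained in no minimal prime. -/
theorem Ring.KrullDimLE.quotient_of_not_le {n : ℕ} [h : Ring.KrullDimLE (n + 1) R] {I : Ideal R}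
    (hI : ∀ p ∈ minimalPrimes R, ¬ I ≤ p) : Ring.KrullDimLE n (R ⧸ I) := by
  rw [Ring.krullDimLE_iff] at h ⊢
  rw [ringKrullDim_quotient, Order.krullDim, iSup_le_iff]
  intro l
  obtain ⟨p, hp, hp'⟩ := Ideal.exists_minimalPrimes_le (J := l.head.1.asIdeal) bot_le
  let p' : PrimeSpectrum R := ⟨p, hp.1.1⟩
  have hp' : p' < l.head := lt_of_le_of_ne hp' fun h ↦
    hI p hp (by have := l.head.2; rw [PrimeSpectrum.mem_zeroLocus, ← h] at this; exact this)
  have := Order.LTSeries.length_le_krullDim ((l.map Subtype.val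
    (Subtype.strictMono_coe _)).cons p' hp')
  have := this.trans h
  norm_cast at this ⊢
  have : 0 + l.length + 1 ≤ n + 1 := this
  omega

end Dimension

section Avoidance

variable {k R : Type*} [Field k] [CommRing R] [Algebra k R]

theorem finite_setOf_sum_pow_smul_mem {n : ℕ} (v : Fin n → R) {S : Set (Ideal R)} (hS : S.Finite)
    (h : ∀ p ∈ S, p.IsPrime ∧ ∃ i, v i ∉ p) :
    {s : k | ∃ p ∈ S, ∑ i : Fin n, s ^ (i : ℕ) • v i ∈ p}.Finite := by
  classical
  have : {s : k | ∃ p ∈ S, ∑ i : Fin n, s ^ (i : ℕ) • v i ∈ p} =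
      ⋃ p ∈ S, {s : k | ∑ i : Fin n, s ^ (i : ℕ) • v i ∈ p} := by
    ext; simp
  rw [this]
  refine hS.biUnion fun p hp => ?_
  obtain ⟨h1, i, hi⟩ := h p hp
  let f : Polynomial (R ⧸ p) :=
    ∑ i, Polynomial.C (Ideal.Quotient.mk p (v i)) * Polynomial.X ^ (i : ℕ)
  have hf : f ≠ 0 := by
    intro h0
    have := congrArg (fun g => Polynomial.coeff g i) h0
    simp only [f, Polynomial.finsetSum_coeff, Polynomial.coeff_C_mul, Polynomial.coeff_X_pow,
      Polynomial.coeff_zero, Fin.val_inj] at this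
    simp [Ideal.Quotient.eq_zero_iff_mem, hi] at this
  have hinj : Function.Injective (algebraMap k (R ⧸ p)) := (algebraMap k (R ⧸ p)).injective
  refine Set.Finite.subset ((f.roots.toFinset.finite_toSet).preimage hinj.injOn) ?_
  intro s hs
  simp only [Set.mem_ofPred_eq] at hs
  simp only [Set.mem_preimage, Finset.mem_coe, Multiset.mem_toFinset, Polynomial.mem_roots hf,
    Polynomial.IsRoot.def, f, Polynomial.eval_finsetSum, Polynomial.eval_mul, Polynomial.eval_C,
    Polynomial.eval_pow, Polynomial.eval_X]
  rw [← Ideal.Quotient.eq_zero_iff_mem, map_sum] at hs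
  rw [← hs]
  refine Finset.sum_congr rfl fun i _ => ?_
  rw [Algebra.smul_def, map_mul, map_pow, map_pow, mul_comm]
  rfl

theorem finite_setOf_add_smul_mem (a b : R) {S : Set (Ideal R)} (hS : S.Finite)
    (h : ∀ p ∈ S, p.IsPrime ∧ (a ∈ p → b ∉ p)) :
    {s : k | ∃ p ∈ S, a + s • b ∈ p}.Finite := by
  have := finite_setOf_sum_pow_smul_mem (k := k) ![a, b] hS fun p hp => ⟨(h p hp).1, by
    by_cases ha : a ∈ p
    · exact ⟨1, (h p hp).2 ha⟩
    · exact ⟨0, ha⟩⟩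
  simpa [Fin.sum_univ_two] using this

end Avoidance

section Torsion

/-- Units of a finite algebra over an algebraic extension of a finite field are torsion. -/
theorem exists_pow_eq_one_of_finite (p : ℕ) [Fact p.Prime] (k : Type*) [Field k]
    [Algebra (ZMod p) k] [Algebra.IsIntegral (ZMod p) k] {B : Type*} [CommRing B] [Algebra k B] [Module.Finite k B]
    {u : B} (hu : IsUnit u) : ∃ M, M ≠ 0 ∧ u ^ M = 1 := by
  let : Algebra (ZMod p) B := ((algebraMap k B).comp (algebraMap (ZMod p) k)).toAlgebra
  have : IsScalarTower (ZMod p) k B := IsScalarTower.of_algebraMap_eq fun _ => rfl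
  have hinteg : IsIntegral (ZMod p) u :=
    isIntegral_trans (R := ZMod p) (A := k) u (Algebra.IsIntegral.isIntegral u)
  have hfin : Module.Finite (ZMod p) (Algebra.adjoin (ZMod p) {u}) :=
    Module.Finite.iff_fg.2 hinteg.fg_adjoin_singleton
  have : Finite (Algebra.adjoin (ZMod p) {u}) := Module.finite_of_finite (ZMod p)
  let f : ℕ → Algebra.adjoin (ZMod p) {u} := fun n =>
    ⟨u ^ n, pow_mem (Algebra.subset_adjoin (Set.mem_singleton u)) n⟩
  obtain ⟨a, b, hab, h⟩ := Finite.exists_ne_map_eq_of_infinite f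
  have h : u ^ a = u ^ b := congrArg Subtype.val h
  have key : ∀ a b : ℕ, a < b → u ^ a = u ^ b → ∃ M, M ≠ 0 ∧ u ^ M = 1 := by
    intro a b hab h
    refine ⟨b - a, by omega, ?_⟩
    refine (hu.pow a).mul_left_cancel ?_
    rw [← pow_add, mul_one, h]
    congr 1
    omega
  rcases lt_or_gt_of_ne hab with h1 | h1
  · exact key a b h1 h
  · exact key b a h1 h.symm

theorem exists_dvd_pow_sub_one (p : ℕ) [Fact p.Prime] (k : Type*) [Field k] [Algebra (ZMod p) k]
    [Algebra.IsIntegral (ZMod p) k] {C : Type*} [CommRing C] [Algebra k C] [Algebra.FiniteType k C]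
    [Ring.KrullDimLE 1 C] {f g : C} (hg : ∀ q ∈ minimalPrimes C, g ∉ q) (h : IsCoprime f g) :
    ∃ M, M ≠ 0 ∧ g ∣ f ^ M - 1 := by
  have h1 : Ring.KrullDimLE 0 (C ⧸ Ideal.span {g}) :=
    Ring.KrullDimLE.quotient_of_not_le fun q hq hle => hg q hq (hle (Ideal.subset_span rfl))
  have h2 : Module.Finite k (C ⧸ Ideal.span {g}) := (Module.finite_iff_krullDimLE_zero k _).2 h1
  have h3 : IsUnit (Ideal.Quotient.mk (Ideal.span {g}) f) := by
    obtain ⟨a, b, hab⟩ := h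
    refine IsUnit.of_mul_eq_one (Ideal.Quotient.mk _ a) ?_
    rw [← map_mul, ← map_one (Ideal.Quotient.mk _), Ideal.Quotient.mk_eq_mk_iff_sub_mem,
      Ideal.mem_span_singleton]
    exact ⟨-b, by linear_combination hab⟩
  obtain ⟨M, hM, h4⟩ := exists_pow_eq_one_of_finite p k h3
  refine ⟨M, hM, ?_⟩
  rwa [← map_pow, ← map_one (Ideal.Quotient.mk _), Ideal.Quotient.mk_eq_mk_iff_sub_mem,
      Ideal.mem_span_singleton] at h4

end Torsion

section ClassNumber

open Polynomial

theorem exists_dvd_mul_of_finite_polynomial (F S : Type*) [Field F] [Finite F] [CommRing S]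
    [IsDomain S] [Algebra F[X] S] [Module.Finite F[X] S] [Module.IsTorsionFree F[X] S] :
    ∃ M : S, M ≠ 0 ∧ ∀ I : Ideal S, I ≠ ⊥ → ∃ b ∈ I, b ≠ 0 ∧ ∀ a ∈ I, b ∣ M * a := by
  classical
  have := Fintype.ofFinite F
  have : Module.Free F[X] S := Module.free_of_finite_type_torsion_free'
  let bS := Module.Free.chooseBasis F[X] S
  let adm := cardPowDegreeIsAdmissible (Fq := F)
  refine ⟨_, ClassGroup.prod_finsetApprox_ne_zero bS adm, fun I hI ↦ ?_⟩
  obtain ⟨b, hb, hb0, hmin⟩ := ClassGroup.exists_min (R := F[X]) cardPowDegree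
    ⟨I, mem_nonZeroDivisors_iff_ne_zero.mpr hI⟩
  refine ⟨b, hb, hb0, fun a ha ↦ ?_⟩
  obtain ⟨q, r, hr, hlt⟩ := ClassGroup.exists_mem_finset_approx' bS adm a hb0
  have := hmin _ (sub_mem (I.smul_of_tower_mem r ha) (I.mul_mem_left q hb)) hlt
  rw [sub_eq_zero, Algebra.smul_def] at this
  refine (Dvd.intro_left q this.symm).trans (mul_dvd_mul_right (map_dvd _ ?_) a)
  exact Finset.dvd_prod_of_mem _ hr

theorem Polynomial.hasFiniteQuotients (F : Type*) [Field F] [Finite F] :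
    Ring.HasFiniteQuotients F[X] where
  finiteQuotient {I} hI := by
    obtain ⟨f, rfl⟩ := (IsPrincipalIdealRing.principal I).principal
    have hf : f ≠ 0 := by rintro rfl; simp at hI
    have : Module.Finite F (AdjoinRoot f) := (AdjoinRoot.powerBasis hf).finite
    exact Module.finite_of_finite F (M := AdjoinRoot f)

/-- Invertible ideals of a finite torsion-free extension of `F[X]`, with `F` a finite field,
are torsion. -/
theorem exists_pow_eq_span_of_finite_polynomial (F : Type*) {S : Type*} [Field F] [Finite F]
    [CommRing S] [IsDomain S] [Algebra F[X] S] [Module.Finite F[X] S]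
    [Module.IsTorsionFree F[X] S] {q q' : Ideal S} {x : S} (hx : x ≠ 0)
    (h : q * q' = Ideal.span {x}) : ∃ N, N ≠ 0 ∧ ∃ f, q ^ N = Ideal.span {f} := by
  have := Polynomial.hasFiniteQuotients F
  have := Ring.HasFiniteQuotients.of_module_finite F[X] S
  obtain ⟨M, hM, H⟩ := exists_dvd_mul_of_finite_polynomial F S
  have hq : q ≠ ⊥ := by
    rintro rfl
    rw [Ideal.bot_mul, eq_comm, Ideal.span_singleton_eq_bot] at h
    exact hx h
  choose b hb hb0 hdvd using fun i : ℕ ↦ H (q ^ i) (pow_ne_zero i hq)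
  let J : ℕ → Ideal S := fun i ↦
    Submodule.comap (LinearMap.mulRight S (b i)) (Ideal.span {M} * q ^ i)
  have hJ (i : ℕ) : Ideal.span {b i} * J i = Ideal.span {M} * q ^ i := by
    apply le_antisymm
    · rw [Ideal.span_singleton_mul_le_iff]
      intro z hz
      simpa [J, mul_comm] using hz
    · rw [Ideal.span_singleton_mul_le_iff]
      intro a ha
      obtain ⟨c, hc⟩ := hdvd i a ha
      rw [hc]
      refine Ideal.mul_mem_mul (Ideal.mem_span_singleton_self _) ?_
      simp only [J, Submodule.mem_comap, LinearMap.mulRight_apply]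
      rw [mul_comm c, ← hc]
      exact Ideal.mul_mem_mul (Ideal.mem_span_singleton_self _) ha
  have hfin := Ring.HasFiniteQuotients.finite_setOfPred_mem M hM
  have hmem (i : ℕ) : J i ∈ {I : Ideal S | M ∈ I} :=
    Ideal.mul_mem_mul (Ideal.mem_span_singleton_self _) (hb i)
  have : Finite {I : Ideal S | M ∈ I} := hfin
  obtain ⟨i, j, hij, hJij⟩ := Finite.exists_ne_map_eq_of_infinite
    (fun i ↦ (⟨J i, hmem i⟩ : {I : Ideal S | M ∈ I}))
  wlog hlt : j < i generalizing i j
  · exact this j i hij.symm hJij.symm (by omega)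
  replace hJij : J i = J j := congrArg Subtype.val hJij
  have h1 : Ideal.span {M * x ^ j} * (Ideal.span {b j} * q ^ (i - j)) =
      Ideal.span {M * x ^ j} * Ideal.span {b i} := by
    have e1 : Ideal.span {b j} * (Ideal.span {M} * q ^ i) =
        Ideal.span {b i} * (Ideal.span {M} * q ^ j) := by
      rw [← hJ, ← hJ, hJij, mul_left_comm]
    have e2 : q ^ i = q ^ (i - j) * q ^ j := by rw [← pow_add]; congr 1; omega
    rw [← Ideal.span_singleton_mul_span_singleton, ← Ideal.span_singleton_pow, ← h, mul_pow]
    calc _ = (Ideal.span {b j} * (Ideal.span {M} * (q ^ (i - j) * q ^ j))) * q' ^ j := by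
          generalize q ^ (i - j) = u; ring
      _ = _ := by rw [← e2, e1]; ring
  have hMx : M * x ^ j ≠ 0 := mul_ne_zero hM (pow_ne_zero _ hx)
  have h2 := Ideal.span_singleton_mul_right_injective hMx h1
  have h3 : b i ∈ Ideal.span {b j} * q ^ (i - j) := h2 ▸ Ideal.mem_span_singleton_self _
  obtain ⟨g, hg, hg'⟩ := Ideal.mem_span_singleton_mul.mp h3
  refine ⟨i - j, by omega, g, ?_⟩
  apply Ideal.span_singleton_mul_right_injective (hb0 j)
  simp only
  rw [h2, ← hg', Ideal.span_singleton_mul_span_singleton]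

end ClassNumber

open Cardinal in
/-- A finitely generated domain of dimension at most one has transcendence degree at most one. -/
theorem trdeg_le_one_of_krullDimLE (k D : Type*) [Field k] [CommRing D] [IsDomain D] [Algebra k D]
    [Algebra.FiniteType k D] [Ring.KrullDimLE 1 D] : Algebra.trdeg k D ≤ 1 := by
  obtain ⟨s, g, hg, hinteg⟩ := exists_integral_inj_algHom_of_fg k D
  have hs : s ≤ 1 := by
    by_contra! hs
    algebraize [g.toRingHom]
    have hker : RingHom.ker (algebraMap (MvPolynomial (Fin s) k) D) = ⊥ :=
      (RingHom.injective_iff_ker_eq_bot _).mp hg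
    let i₀ : Fin s := ⟨0, by omega⟩
    let i₁ : Fin s := ⟨1, by omega⟩
    have hprime : (Ideal.span {(MvPolynomial.X i₀ : MvPolynomial (Fin s) k)}).IsPrime :=
      (Ideal.span_singleton_prime (MvPolynomial.X_ne_zero _)).mpr MvPolynomial.X_prime
    obtain ⟨Q, hQ, hQ'⟩ := Ideal.exists_ideal_over_prime_of_isIntegral_of_isDomain
      (S := D) (Ideal.span {(MvPolynomial.X i₀ : MvPolynomial (Fin s) k)}) (hker.trans_le bot_le)
    have hQ0 : Q ≠ ⊥ := by
      rintro rfl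
      have : Ideal.span {(MvPolynomial.X i₀ : MvPolynomial (Fin s) k)} = ⊥ := by
        rw [← hQ', ← RingHom.ker_eq_comap_bot]; exact hker
      simp [MvPolynomial.X_ne_zero] at this
    have := Q.isMaximal_of_isPrime_of_ne_bot hQ0
    have hmax := Ideal.isMaximal_comap_of_isIntegral_of_isMaximal
      (R := MvPolynomial (Fin s) k) Q
    rw [hQ'] at hmax
    have := hmax.eq_of_le (J := RingHom.ker (MvPolynomial.constantCoeff (R := k)))
      (RingHom.ker_ne_top _) (by
        rw [Ideal.span_singleton_le_iff_mem, RingHom.mem_ker, MvPolynomial.constantCoeff_X])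
    have h1 : (MvPolynomial.X i₁ : MvPolynomial (Fin s) k) ∈ Ideal.span {MvPolynomial.X i₀} := by
      rw [this, RingHom.mem_ker, MvPolynomial.constantCoeff_X]
    rw [Ideal.mem_span_singleton, MvPolynomial.X_dvd_X] at h1
    simp [i₀, i₁] at h1
  let x : Fin s → D := fun i ↦ g (MvPolynomial.X i)
  have : Algebra.IsAlgebraic (Algebra.adjoin k (Set.range x)) D := by
    have hr : Algebra.adjoin k (Set.range x) = g.range := by
      rw [← Algebra.map_top, ← MvPolynomial.adjoin_range_X, AlgHom.map_adjoin, ← Set.range_comp]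
      rfl
    rw [hr]
    have : Algebra.IsIntegral g.range D := ⟨fun z ↦ by
      obtain ⟨P, hP, hz⟩ := hinteg z
      refine ⟨P.map g.rangeRestrict.toRingHom, hP.map _, ?_⟩
      rw [Polynomial.eval₂_map]
      exact hz⟩
    exact Algebra.IsIntegral.isAlgebraic
  refine (Algebra.IsAlgebraic.trdeg_le_cardinalMk k (Set.range x)).trans ?_
  have : Subsingleton (Fin s) := Fin.subsingleton_iff_le_one.mpr hs
  rw [Cardinal.mk_le_one_iff_set_subsingleton]
  exact Set.subsingleton_range x

theorem exists_pow_eq_span_of_finite_field (F : Type*) {S : Type*} [Field F] [Finite F]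
    [CommRing S] [IsDomain S] [Algebra F S] [Algebra.FiniteType F S]
    (hdim : ∀ (s : ℕ) (v : Fin s → S), AlgebraicIndependent F v → s ≤ 1)
    {q q' : Ideal S} {x : S} (hx : x ≠ 0)
    (h : q * q' = Ideal.span {x}) : ∃ N, N ≠ 0 ∧ ∃ f, q ^ N = Ideal.span {f} := by
  obtain ⟨s, g, hg, hinteg⟩ := exists_finite_inj_algHom_of_fg F S
  have hs := hdim s (fun i ↦ g (MvPolynomial.X i)) (by
    have : MvPolynomial.aeval (fun i ↦ g (MvPolynomial.X i)) = g := by ext; simp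
    rwa [AlgebraicIndependent, this])
  obtain rfl | rfl : s = 0 ∨ s = 1 := by omega
  · have hi : g.toRingHom.IsIntegral := hinteg.to_isIntegral
    have hfield : IsField S := by
      algebraize [g.toRingHom]
      exact isField_of_isIntegral_of_isField' (R := MvPolynomial (Fin 0) F)
        ((MvPolynomial.isEmptyAlgEquiv F (Fin 0)).toMulEquiv.isField (Field.toIsField F))
    let := hfield.toField
    refine ⟨1, one_ne_zero, 1, ?_⟩
    rw [pow_one, Ideal.span_singleton_one]
    refine (Ideal.eq_bot_or_top q).resolve_left ?_
    rintro rfl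
    rw [Ideal.bot_mul, eq_comm, Ideal.span_singleton_eq_bot] at h
    exact hx h
  · let e := MvPolynomial.uniqueAlgEquiv F (Fin 1)
    let f : Polynomial F →+* S := g.toRingHom.comp e.symm.toRingEquiv.toRingHom
    have hf : Function.Injective f := hg.comp e.symm.injective
    have hfin : f.Finite := RingHom.Finite.comp hinteg (RingHom.Finite.of_surjective _ e.symm.surjective)
    algebraize [f]
    have : Module.IsTorsionFree (Polynomial F) S := by
      have : FaithfulSMul (Polynomial F) S := (faithfulSMul_iff_algebraMap_injective _ _).mpr hf
      infer_instance
    exact exists_pow_eq_span_of_finite_polynomial F hx h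

theorem Ideal.exists_sum_mul_of_mem_mul {R : Type*} [CommRing R] {I J : Ideal R} {x : R}
    (hx : x ∈ I * J) : ∃ (n : ℕ) (a b : Fin n → R), (∀ i, a i ∈ I) ∧ (∀ i, b i ∈ J) ∧
      ∑ i, a i * b i = x := by
  induction hx using Submodule.mul_induction_on' with
  | mem_mul_mem a ha b hb => exact ⟨1, fun _ ↦ a, fun _ ↦ b, fun _ ↦ ha, fun _ ↦ hb, by simp⟩
  | add x _ y _ hx hy =>
    obtain ⟨n, a, b, ha, hb, rfl⟩ := hx
    obtain ⟨m, a', b', ha', hb', rfl⟩ := hy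
    refine ⟨n + m, Fin.append a a', Fin.append b b', fun i ↦ ?_, fun i ↦ ?_, by
      simp [Fin.sum_univ_add]⟩
    · induction i using Fin.addCases <;> simp [ha, ha']
    · induction i using Fin.addCases <;> simp [hb, hb']

/-- Invertible ideals of a finitely generated domain of dimension at most one over an
algebraic extension of a finite field are torsion. -/
theorem exists_pow_eq_span_of_isDomain (p : ℕ) [Fact p.Prime] (k : Type*) {D : Type*} [Field k]
    [Algebra (ZMod p) k] [Algebra.IsIntegral (ZMod p) k] [CommRing D] [IsDomain D] [Algebra k D]
    [Algebra.FiniteType k D] [Ring.KrullDimLE 1 D] {q q' : Ideal D} {x : D} (hx : x ≠ 0)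
    (h : q * q' = Ideal.span {x}) : ∃ N, N ≠ 0 ∧ ∃ f, q ^ N = Ideal.span {f} := by
  classical
  let : Algebra (ZMod p) D := ((algebraMap k D).comp (algebraMap (ZMod p) k)).toAlgebra
  have : IsScalarTower (ZMod p) k D := .of_algebraMap_eq' rfl
  obtain ⟨n, a, b, ha, hb, hab⟩ := Ideal.exists_sum_mul_of_mem_mul
    (h ▸ Ideal.mem_span_singleton_self x)
  have hs (i j : Fin n) : ∃ s, a i * b j = x * s := by
    have := Ideal.mul_mem_mul (ha i) (hb j)
    rwa [h, Ideal.mem_span_singleton] at this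
  choose s hs using hs
  have hqa : q = Ideal.span (Set.range a) := by
    apply le_antisymm
    · intro y hy
      have (i : Fin n) : ∃ c, y * b i = x * c := by
        have := Ideal.mul_mem_mul hy (hb i)
        rwa [h, Ideal.mem_span_singleton] at this
      choose c hc using this
      have : y = ∑ i, c i * a i := by
        apply mul_left_cancel₀ hx
        rw [Finset.mul_sum]
        nth_rw 1 [← hab]
        rw [Finset.sum_mul]
        refine Finset.sum_congr rfl fun i _ ↦ ?_
        linear_combination a i * hc i
      rw [this]
      exact sum_mem fun i _ ↦ Ideal.mul_mem_left _ _ (Ideal.subset_span ⟨i, rfl⟩)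
    · rw [Ideal.span_le]
      rintro _ ⟨i, rfl⟩
      exact ha i
  let T : Set D := Set.range a ∪ Set.range b ∪ Set.range (fun z : Fin n × Fin n ↦ s z.1 z.2)
  let D₀ := Algebra.adjoin (ZMod p) T
  have : Algebra.FiniteType (ZMod p) D₀ := by
    have hT : T.Finite := ((Set.finite_range _).union (Set.finite_range _)).union
      (Set.finite_range _)
    exact (Subalgebra.fg_iff_finiteType _).mp ⟨hT.toFinset, by simp [D₀]⟩
  have hTD (z : D) (hz : z ∈ T) : z ∈ D₀ := Algebra.subset_adjoin hz
  let a₀ : Fin n → D₀ := fun i ↦ ⟨a i, hTD _ (.inl (.inl ⟨i, rfl⟩))⟩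
  let b₀ : Fin n → D₀ := fun i ↦ ⟨b i, hTD _ (.inl (.inr ⟨i, rfl⟩))⟩
  let s₀ : Fin n → Fin n → D₀ := fun i j ↦ ⟨s i j, hTD _ (.inr ⟨(i, j), rfl⟩)⟩
  let x₀ : D₀ := ∑ i, a₀ i * b₀ i
  have hx₀ : (x₀ : D) = x := by simp [x₀, a₀, b₀, hab]
  have hmul : Ideal.span (Set.range a₀) * Ideal.span (Set.range b₀) = Ideal.span {x₀} := by
    apply le_antisymm
    · rw [Ideal.span_mul_span', Ideal.span_le]
      rintro _ ⟨_, ⟨i, rfl⟩, _, ⟨j, rfl⟩, rfl⟩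
      refine Ideal.mem_span_singleton.mpr ⟨s₀ i j, Subtype.ext ?_⟩
      simp [hx₀, a₀, b₀, s₀, hs]
    · rw [Ideal.span_singleton_le_iff_mem]
      exact sum_mem fun i _ ↦ Ideal.mul_mem_mul (Ideal.subset_span ⟨i, rfl⟩)
        (Ideal.subset_span ⟨i, rfl⟩)
  obtain ⟨N, hN, f, hf⟩ := exists_pow_eq_span_of_finite_field (ZMod p) (x := x₀) (fun m v hv ↦ by
    have h1 : AlgebraicIndependent (ZMod p) (D₀.val ∘ v) := hv.map' Subtype.val_injective
    have h2 : AlgebraicIndependent k (D₀.val ∘ v) := h1.extendScalars_of_isIntegral k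
    have h3 := h2.lift_cardinalMk_le_trdeg.trans
      (Cardinal.lift_le.mpr (trdeg_le_one_of_krullDimLE k D))
    simpa using h3) (by rintro h0; rw [h0] at hx₀; exact hx hx₀.symm) hmul
  refine ⟨N, hN, f, ?_⟩
  have := congrArg (Ideal.map D₀.val) hf
  rw [Ideal.map_pow, Ideal.map_span, Ideal.map_span, ← Set.range_comp, Set.image_singleton] at this
  rw [hqa]
  exact this

section Separating

variable {C : Type*} [CommRing C]

/-- `u P` lies in every minimal prime but `P`, for every minimal prime `P`. -/
def IsSeparating (Φ : Finset (Ideal C)) (u : Ideal C → C) : Prop :=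
  (∀ P, P ∈ Φ ↔ P ∈ minimalPrimes C) ∧ ∀ P ∈ Φ, u P ∉ P ∧ ∀ Q ∈ Φ, Q ≠ P → u P ∈ Q

theorem exists_isSeparating (C : Type*) [CommRing C] [IsNoetherianRing C] :
    ∃ (Φ : Finset (Ideal C)) (u : Ideal C → C), IsSeparating Φ u := by
  classical
  let Φ := (minimalPrimes.finite_of_isNoetherianRing C).toFinset
  have hΦ (P : Ideal C) : P ∈ Φ ↔ P ∈ minimalPrimes C := Set.Finite.mem_toFinset _
  have (P : Ideal C) : ∃ u, P ∈ Φ → u ∉ P ∧ ∀ Q ∈ Φ, Q ≠ P → u ∈ Q := by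
    by_cases hP : P ∈ Φ
    · have hP' := (hΦ P).mp hP
      have : ¬ (Φ.erase P).inf id ≤ P := by
        intro h
        have := hP'.1.1
        obtain ⟨Q, hQ, hQP⟩ := (Ideal.IsPrime.inf_le' this).mp h
        rw [Finset.mem_erase] at hQ
        exact hQ.1 (le_antisymm hQP (hP'.2 ((hΦ Q).mp hQ.2).1 hQP))
      obtain ⟨u, hu, huP⟩ := SetLike.not_le_iff_exists.mp this
      refine ⟨u, fun _ ↦ ⟨huP, fun Q hQ hQP ↦ ?_⟩⟩
      exact (Finset.inf_le (Finset.mem_erase.mpr ⟨hQP, hQ⟩) : _ ≤ id Q) hu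
    · exact ⟨0, fun h ↦ absurd h hP⟩
  choose u hu using this
  exact ⟨Φ, u, hΦ, hu⟩

namespace IsSeparating

variable {Φ : Finset (Ideal C)} {u : Ideal C → C}

theorem sum_mul_sub_mem (h : IsSeparating Φ u) {P : Ideal C} (hP : P ∈ Φ) (c : Ideal C → C) :
    ∑ Q ∈ Φ, u Q * c Q - u P * c P ∈ P := by
  classical
  rw [← Finset.add_sum_erase _ _ hP, add_sub_cancel_left]
  refine sum_mem fun Q hQ ↦ P.mul_mem_right _ ?_
  rw [Finset.mem_erase] at hQ
  exact (h.2 Q hQ.2).2 P hP hQ.1.symm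

theorem sum_sub_mem (h : IsSeparating Φ u) {P : Ideal C} (hP : P ∈ Φ) : ∑ Q ∈ Φ, u Q - u P ∈ P := by
  simpa using h.sum_mul_sub_mem hP 1

theorem sum_notMem (h : IsSeparating Φ u) {P : Ideal C} (hP : P ∈ Φ) : ∑ Q ∈ Φ, u Q ∉ P := fun hs ↦
  (h.2 P hP).1 ((Submodule.sub_mem_iff_right _ hs).mp (h.sum_sub_mem hP))

theorem mul_eq_zero [IsReduced C] (h : IsSeparating Φ u) {P : Ideal C} (hP : P ∈ Φ) {x : C} (hx : x ∈ P) :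
    u P * x = 0 := by
  have : u P * x ∈ sInf (⊥ : Ideal C).minimalPrimes := by
    rw [Ideal.mem_sInf]
    intro Q hQ
    rcases eq_or_ne Q P with rfl | hne
    · exact Q.mul_mem_left _ hx
    · exact Q.mul_mem_right _ ((h.2 P hP).2 Q ((h.1 Q).mpr hQ) hne)
  rwa [Ideal.sInf_minimalPrimes, (Ideal.isRadical_bot_iff.mpr ‹_›).radical, Ideal.mem_bot] at this

theorem mul_eq_mul [IsReduced C] (h : IsSeparating Φ u) {P : Ideal C} (hP : P ∈ Φ) {x y : C} (hxy : x - y ∈ P) :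
    u P * x = u P * y := by
  rw [← sub_eq_zero, ← mul_sub, h.mul_eq_zero hP hxy]

theorem isCoprime_sum [IsReduced C] (h : IsSeparating Φ u) (c : Ideal C → C) :
    IsCoprime (∑ P ∈ Φ, u P) (1 + ∑ P ∈ Φ, u P * c P) := by
  set F := ∑ P ∈ Φ, u P * c P with hF
  have : F * F = (∑ P ∈ Φ, u P * (c P * c P)) * ∑ P ∈ Φ, u P := by
    nth_rw 1 [hF]
    rw [Finset.mul_sum, Finset.sum_mul]
    refine Finset.sum_congr rfl fun P hP ↦ ?_
    have h1 := h.mul_eq_mul hP (h.sum_mul_sub_mem hP c)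
    have h2 := h.mul_eq_mul hP (h.sum_sub_mem hP)
    rw [← hF] at h1
    linear_combination c P * h1 - c P * c P * h2
  exact ⟨∑ P ∈ Φ, u P * (c P * c P), 1 - F, by linear_combination -this⟩

end IsSeparating

end Separating

theorem exists_pow_eq_span_of_isReduced (p : ℕ) [Fact p.Prime] (k : Type*) {C : Type*} [Field k]
    [Algebra (ZMod p) k] [Algebra.IsIntegral (ZMod p) k] [CommRing C] [IsReduced C] [Algebra k C]
    [Algebra.FiniteType k C] [Ring.KrullDimLE 1 C] {Φ : Finset (Ideal C)} {u : Ideal C → C}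
    (hu : IsSeparating Φ u) {q q' : Ideal C} {x : C} (hx : ∀ P ∈ Φ, x ∉ P)
    (hxu : IsCoprime x (∑ P ∈ Φ, u P))
    (h : q * q' = Ideal.span {x}) : ∃ N, N ≠ 0 ∧ ∃ f, q ^ N = Ideal.span {f} := by
  classical
  obtain ⟨N, hN, hNg⟩ := exists_common_pow Φ
    (P := fun P N ↦ ∃ g : C, (q.map (Ideal.Quotient.mk P)) ^ N =
      Ideal.span {Ideal.Quotient.mk P g}) (fun P hP ↦ by
      have := ((hu.1 P).mp hP).1.1
      have := Ring.KrullDimLE.quotient (n := 1) P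
      have h' := congrArg (Ideal.map (Ideal.Quotient.mk P)) h
      rw [Ideal.map_mul, Ideal.map_span, Set.image_singleton] at h'
      obtain ⟨N, hN, f, hf⟩ := exists_pow_eq_span_of_isDomain p k
        (by rw [Ne, Ideal.Quotient.eq_zero_iff_mem]; exact hx P hP) h'
      obtain ⟨g, rfl⟩ := Ideal.Quotient.mk_surjective f
      exact ⟨N, hN, g, hf⟩) (fun P M N _ ⟨g, hg⟩ ↦ ⟨g ^ N, by
        rw [pow_mul, hg, Ideal.span_singleton_pow, map_pow]⟩)
  choose! g hg using hNg
  have hxq : x ∈ q := Ideal.mul_le_left (h ▸ Ideal.mem_span_singleton_self x)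
  obtain ⟨M, hM, hMh⟩ := exists_common_pow Φ
    (P := fun P M ↦ Ideal.Quotient.mk P (u P) ∣ Ideal.Quotient.mk P (g P) ^ M - 1) (fun P hP ↦ by
      have := ((hu.1 P).mp hP).1.1
      have := Ring.KrullDimLE.quotient (n := 1) P
      refine exists_dvd_pow_sub_one p k (fun Q hQ ↦ ?_) ?_
      · rw [IsDomain.minimalPrimes_eq_singleton_bot, Set.mem_singleton_iff] at hQ
        rw [hQ, Ideal.mem_bot, Ideal.Quotient.eq_zero_iff_mem]
        exact (hu.2 P hP).1
      · have h1 : Ideal.Quotient.mk P (g P) ∣ Ideal.Quotient.mk P x ^ N := by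
          rw [← Ideal.mem_span_singleton, ← hg P hP]
          exact Ideal.pow_mem_pow (Ideal.mem_map_of_mem _ hxq) _
        refine IsCoprime.of_isCoprime_of_dvd_left ?_ h1
        have h2 := (hxu.map (Ideal.Quotient.mk P)).pow_left (m := N)
        rwa [Ideal.Quotient.eq.mpr (hu.sum_sub_mem hP)] at h2) (fun P M N _ hd ↦
          dvd_pow_mul_sub_one hd N)
  have hh (P : Ideal C) : ∃ c, P ∈ Φ →
      Ideal.Quotient.mk P (g P) ^ M = Ideal.Quotient.mk P (1 + u P * c) := by
    by_cases hP : P ∈ Φ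
    · obtain ⟨c, hc⟩ := hMh P hP
      obtain ⟨c, rfl⟩ := Ideal.Quotient.mk_surjective c
      exact ⟨c, fun _ ↦ by rw [map_add, map_mul, map_one, ← hc]; ring⟩
    · exact ⟨0, fun h ↦ absurd h hP⟩
  choose c hc using hh
  let f := 1 + ∑ P ∈ Φ, u P * c P
  have hf (P : Ideal C) (hP : P ∈ Φ) :
      (q ^ (N * M)).map (Ideal.Quotient.mk P) = Ideal.span {Ideal.Quotient.mk P f} := by
    rw [Ideal.map_pow, pow_mul, hg P hP, Ideal.span_singleton_pow, hc P hP]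
    congr 2
    rw [eq_comm, Ideal.Quotient.eq]
    simpa [f] using hu.sum_mul_sub_mem hP c
  refine ⟨N * M, mul_ne_zero hN hM, f, le_antisymm (fun b hb ↦ ?_) ?_⟩
  · have h1 : f ∣ (∑ P ∈ Φ, u P) * b := by
      rw [Finset.sum_mul]
      refine Finset.dvd_sum fun P hP ↦ ?_
      have := Ideal.mem_map_of_mem (Ideal.Quotient.mk P) hb
      rw [hf P hP, Ideal.mem_span_singleton] at this
      obtain ⟨z, hz⟩ := this
      obtain ⟨z, rfl⟩ := Ideal.Quotient.mk_surjective z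
      rw [← map_mul, Ideal.Quotient.eq] at hz
      rw [hu.mul_eq_mul hP hz]
      exact ⟨u P * z, by ring⟩
    exact Ideal.mem_span_singleton.mpr ((hu.isCoprime_sum c).symm.dvd_of_dvd_mul_left h1)
  · rw [Ideal.span_singleton_le_iff_mem]
    have h1 : (∑ P ∈ Φ, u P) * f ∈ q ^ (N * M) := by
      rw [Finset.sum_mul]
      refine sum_mem fun P hP ↦ ?_
      have : Ideal.Quotient.mk P f ∈ (q ^ (N * M)).map (Ideal.Quotient.mk P) := by
        rw [hf P hP]; exact Ideal.mem_span_singleton_self _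
      obtain ⟨z, hz, hzf⟩ := (Ideal.mem_map_iff_of_surjective _
        Ideal.Quotient.mk_surjective).mp this
      rw [eq_comm, Ideal.Quotient.eq] at hzf
      rw [hu.mul_eq_mul hP hzf]
      exact Ideal.mul_mem_left _ _ hz
    obtain ⟨r, s, hrs⟩ := hxu.pow_left (m := N * M)
    have : f = r * f * x ^ (N * M) + s * ((∑ P ∈ Φ, u P) * f) := by
      linear_combination -f * hrs
    rw [this]
    exact add_mem (Ideal.mul_mem_left _ _ (Ideal.pow_mem_pow hxq _)) (Ideal.mul_mem_left _ _ h1)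

theorem Ring.KrullDimLE.localization {R S : Type*} [CommRing R] [CommRing S] [Algebra R S]
    (M : Submonoid R) [IsLocalization M S] {n : ℕ} [h : Ring.KrullDimLE n R] :
    Ring.KrullDimLE n S := by
  rw [Ring.krullDimLE_iff] at h ⊢
  refine le_trans ?_ h
  refine Order.krullDim_le_of_strictMono (PrimeSpectrum.comap (algebraMap R S)) ?_
  have hinj := PrimeSpectrum.localization_comap_injective S M
  refine Monotone.strictMono_of_injective (fun P Q hPQ ↦ ?_) hinj
  exact Ideal.comap_mono hPQ

section Relation

open MvPolynomial

/-- Over a perfect field of characteristic `p`, a nontrivial algebraic relation of minimal degree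
is irreducible and has a nonzero partial derivative. -/
theorem exists_irreducible_relation (p : ℕ) [Fact p.Prime] {k K : Type*} [Field k] [CharP k p]
    [PerfectField k] [Field K] [Algebra k K] {ι : Type*} (a : ι → K)
    (h : ¬ AlgebraicIndependent k a) :
    ∃ F : MvPolynomial ι k, Irreducible F ∧ aeval a F = 0 ∧ ∃ i, pderiv i F ≠ 0 := by
  classical
  have hp : p.Prime := Fact.out
  rw [algebraicIndependent_iff] at h
  push Not at h
  obtain ⟨F, ⟨hFa, hF0⟩, hmin⟩ := exists_minimalFor_of_wellFoundedLT
    (fun F : MvPolynomial ι k ↦ aeval a F = 0 ∧ F ≠ 0) totalDegree h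
  have hF' (F' : MvPolynomial ι k) (h0 : F' ≠ 0) (h' : aeval a F' = 0) :
      F.totalDegree ≤ F'.totalDegree := by
    by_contra! hlt
    exact hlt.not_ge (hmin ⟨h', h0⟩ hlt.le)
  refine ⟨F, irreducible_of_forall_totalDegree_le hF' hF0 hFa, hFa, ?_⟩
  have : ExpChar k p := .prime hp
  have : CharP K p := .of_ringHom_of_ne_zero (algebraMap k K) p hp.ne_zero
  obtain ⟨i, σ, hσ, hi⟩ := exists_mem_support_not_dvd_of_forall_totalDegree_le p hp
    (fun s hs ↦ by
      apply hs.map_of_injective_injective (frobeniusEquiv k p).symm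
        (frobenius K p).toAddMonoidHom
      · simp
      · simp [frobenius]
      · intro r m
        change ((frobeniusEquiv k p).symm r • m) ^ p = _
        rw [Algebra.smul_def, mul_pow, ← map_pow, frobeniusEquiv_symm_pow_p, Algebra.smul_def]
        rfl) hF' hF0 hFa
  refine ⟨i, fun h0 ↦ ?_⟩
  have hσi : σ i ≠ 0 := by rintro h; simp [h] at hi
  have h1 := congrArg (coeff (σ - Finsupp.single i 1)) h0
  rw [coeff_pderiv, coeff_zero] at h1
  have h2 : σ - Finsupp.single i 1 + Finsupp.single i 1 = σ :=
    tsub_add_cancel_of_le (by simpa [Finsupp.single_le_iff] using Nat.one_le_iff_ne_zero.mpr hσi)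
  rw [h2] at h1
  have h3 : ((σ i : ℕ) : k) ≠ 0 := by rwa [Ne, CharP.cast_eq_zero_iff k p]
  have h4 : (σ - Finsupp.single i 1 : ι →₀ ℕ) i + 1 = σ i := by
    simpa using DFunLike.congr_fun h2 i
  have h5 : (((σ - Finsupp.single i 1 : ι →₀ ℕ) i : k) + 1) = (σ i : ℕ) := by
    rw [← h4, Nat.cast_add, Nat.cast_one]
  rw [h5] at h1
  exact (mul_ne_zero (mem_support_iff.mp hσ) h3) h1

/-- The automorphism `X ↦ X - c Y`, `Y ↦ Y` of `k[X, Y]`. -/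
noncomputable def shear {k : Type*} [CommRing k] (c : k) :
    MvPolynomial (Fin 2) k ≃ₐ[k] MvPolynomial (Fin 2) k :=
  .ofAlgHom (aeval ![X 0 - C c * X 1, X 1]) (aeval ![X 0 + C c * X 1, X 1])
    (by ext i; fin_cases i <;> simp) (by ext i; fin_cases i <;> simp)

theorem pderiv_one_shear {k : Type*} [CommRing k] (c : k) (F : MvPolynomial (Fin 2) k) :
    pderiv 1 (shear c F) = shear c (pderiv 1 F - C c * pderiv 0 F) := by
  let D : Derivation k (MvPolynomial (Fin 2) k) (MvPolynomial (Fin 2) k) :=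
    Derivation.mk' ((shear c).symm.toLinearMap ∘ₗ (pderiv 1).toLinearMap ∘ₗ
      (shear c).toLinearMap) (fun a b ↦ by simp)
  have : D = pderiv 1 - (C c : MvPolynomial (Fin 2) k) • pderiv 0 := by
    refine MvPolynomial.derivation_ext fun i ↦ ?_
    fin_cases i <;> simp [D, shear, pderiv_X]
  have h := DFunLike.congr_fun this F
  apply (shear c).symm.injective
  rw [AlgEquiv.symm_apply_apply]
  exact h

theorem setOf_pderiv_one_shear_eq_zero_subsingleton {k : Type*} [Field k]
    {F : MvPolynomial (Fin 2) k} {i : Fin 2} (hF : pderiv i F ≠ 0) :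
    {c | pderiv 1 (shear c F) = 0}.Subsingleton := by
  intro c hc c' hc'
  have hc : pderiv 1 (shear c F) = 0 := hc
  have hc' : pderiv 1 (shear c' F) = 0 := hc'
  rw [pderiv_one_shear, map_eq_zero_iff _ (shear _).injective] at hc hc'
  by_contra hne
  have h0 : pderiv 0 F = 0 := by
    have : C (c' - c) * pderiv 0 F = 0 := by
      rw [map_sub]; linear_combination hc - hc'
    refine (mul_eq_zero.mp this).resolve_left ?_
    exact (map_ne_zero_iff _ (C_injective _ _)).mpr (sub_ne_zero.mpr (Ne.symm hne))
  have h1 : pderiv 1 F = 0 := by rw [h0, mul_zero, sub_zero] at hc; exact hc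
  fin_cases i
  exacts [hF h0, hF h1]

open Polynomial in
theorem Polynomial.exists_mul_add_mul_derivative_eq_C {R : Type*} [CommRing R] [IsDomain R]
    [NormalizedGCDMonoid R] {f : R[X]} (hf : Irreducible f) (hf' : derivative f ≠ 0) :
    ∃ h ≠ 0, ∃ A B : R[X], A * f + B * derivative f = C h := by
  let K := FractionRing R
  have hdeg : f.natDegree ≠ 0 := fun h ↦ hf' (derivative_of_natDegree_zero h)
  have hK := (hf.isPrimitive hdeg).irreducible_iff_irreducible_map_fraction_map (K := K) |>.mp hf
  have hcop : IsCoprime (f.map (algebraMap R K)) ((derivative f).map (algebraMap R K)) := by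
    refine (hK.coprime_iff_not_dvd).mpr fun hdvd ↦ ?_
    have h0 : (derivative f).map (algebraMap R K) ≠ 0 := by
      rwa [Ne, Polynomial.map_eq_zero_iff (IsFractionRing.injective R K)]
    have := natDegree_le_of_dvd hdvd h0
    rw [natDegree_map_eq_of_injective (IsFractionRing.injective R K),
      natDegree_map_eq_of_injective (IsFractionRing.injective R K)] at this
    exact (natDegree_derivative_lt hdeg).not_ge this
  obtain ⟨a, b, hab⟩ := hcop
  obtain ⟨r, hr, har⟩ := IsLocalization.integerNormalization_spec (nonZeroDivisors R) a
  obtain ⟨s, hs, hbs⟩ := IsLocalization.integerNormalization_spec (nonZeroDivisors R) b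
  refine ⟨r * s, mul_ne_zero (nonZeroDivisors.ne_zero hr) (nonZeroDivisors.ne_zero hs),
    C s * IsLocalization.integerNormalization (nonZeroDivisors R) a,
    C r * IsLocalization.integerNormalization (nonZeroDivisors R) b,
    map_injective _ (IsFractionRing.injective R K) ?_⟩
  simp only [Polynomial.map_add, Polynomial.map_mul, map_C, har, hbs, map_mul, Algebra.smul_def,
    algebraMap_apply]
  linear_combination C (algebraMap R K r) * C (algebraMap R K s) * hab

end Relation

section Specialization

open Polynomial Polynomial.Bivariate

theorem aeval_map_equivMvPolynomial_symm {k E : Type*} [CommRing k] [CommRing E] [Algebra k E]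
    (Q : MvPolynomial (Fin 2) k) (t : k) (y : E) :
    aeval y (((equivMvPolynomial k).symm Q).map (evalRingHom t)) =
      MvPolynomial.aeval ![algebraMap k E t, y] Q := by
  have : ((aeval y).comp ((mapAlgHom (aeval t : k[X] →ₐ[k] k)))).comp
      (equivMvPolynomial k).symm.toAlgHom = MvPolynomial.aeval ![algebraMap k E t, y] := by
    ext i
    fin_cases i
    · simp [aeval_C]
    · simp
  exact DFunLike.congr_fun this Q

theorem exists_finset_separable {k : Type*} [Field k] {Q : MvPolynomial (Fin 2) k}
    (hQ : Irreducible Q) (hQ' : MvPolynomial.pderiv 1 Q ≠ 0) : ∃ T : Finset k, ∀ t ∉ T,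
      (((equivMvPolynomial k).symm Q).map (evalRingHom t)).Separable := by
  classical
  obtain ⟨f, rfl⟩ := (equivMvPolynomial k).surjective Q
  rw [pderiv_one_equivMvPolynomial, map_ne_zero_iff _ (equivMvPolynomial k).injective] at hQ'
  rw [MulEquiv.irreducible_iff] at hQ
  let : NormalizedGCDMonoid k[X] := UniqueFactorizationMonoid.toNormalizedGCDMonoid k[X]
  obtain ⟨h, h0, A, B, hAB⟩ := exists_mul_add_mul_derivative_eq_C hQ hQ'
  refine ⟨h.roots.toFinset, fun t ht ↦ ?_⟩
  rw [AlgEquiv.symm_apply_apply]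
  have hht : h.eval t ≠ 0 := by simpa [h0] using ht
  have h1 := congrArg (Polynomial.map (evalRingHom t)) hAB
  simp only [Polynomial.map_add, Polynomial.map_mul, map_C, ← derivative_map,
    coe_evalRingHom] at h1
  refine ⟨C (h.eval t)⁻¹ * A.map (evalRingHom t), C (h.eval t)⁻¹ * B.map (evalRingHom t), ?_⟩
  have h2 : C (h.eval t)⁻¹ * C (h.eval t) = (1 : k[X]) := by
    rw [← C_mul, inv_mul_cancel₀ hht, C_1]
  linear_combination C (h.eval t)⁻¹ * h1 + h2

theorem Polynomial.Separable.exists_prod_eq_zero {k E : Type*} [Field k] [IsAlgClosed k]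
    [CommRing E] [Algebra k E] {g : k[X]} (hg : g.Separable) {y : E} (h : aeval y g = 0)
    (hy : IsUnit y) : ∃ Λ : Finset k, 0 ∉ Λ ∧ ∏ l ∈ Λ, (y - algebraMap k E l) = 0 := by
  classical
  have hs := (IsAlgClosed.splits g).eq_prod_roots
  have hval : (g.roots.toFinset).val = g.roots :=
    Multiset.dedup_eq_self.mpr (nodup_roots hg)
  have hprod : ∏ l ∈ g.roots.toFinset, (y - algebraMap k E l) = 0 := by
    rw [hs, map_mul, aeval_C] at h
    have hu : IsUnit (algebraMap k E g.leadingCoeff) :=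
      (IsUnit.mk0 _ (leadingCoeff_ne_zero.mpr hg.ne_zero)).map _
    have h' := hu.mul_right_eq_zero.mp h
    rw [map_multiset_prod, Multiset.map_map] at h'
    rw [Finset.prod, hval, ← h']
    congr 1
    refine Multiset.map_congr rfl fun l _ ↦ ?_
    simp
  refine ⟨g.roots.toFinset.erase 0, by simp, ?_⟩
  by_cases h0 : (0 : k) ∈ g.roots.toFinset
  · rw [← Finset.mul_prod_erase _ _ h0, map_zero, sub_zero] at hprod
    exact hy.mul_right_eq_zero.mp hprod
  · rwa [Finset.erase_eq_of_notMem h0]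

end Specialization

theorem exists_dvd_prod_sub_of_isDomain (p : ℕ) [Fact p.Prime] (k : Type*) {D : Type*} [Field k]
    [CharP k p] [IsAlgClosed k] [CommRing D] [IsDomain D] [Algebra k D]
    [Algebra.FiniteType k D] [Ring.KrullDimLE 1 D] {x y : D} (hxy : IsCoprime x y) :
    ∃ T : Finset k, ∀ c ∉ T, ∃ T' : Finset k, ∀ t ∉ T', ∃ Λ : Finset k, 0 ∉ Λ ∧
      x + c • y ^ 2 + t • y ∣ ∏ l ∈ Λ, (y - algebraMap k D l) := by
  classical
  by_cases hy : y = 0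
  · subst hy
    refine ⟨∅, fun c _ ↦ ⟨∅, fun t _ ↦ ⟨∅, by simp, ?_⟩⟩⟩
    simpa [isUnit_iff_dvd_one] using isCoprime_zero_right.mp hxy
  let L := Localization.Away y
  have hle : Submonoid.powers y ≤ nonZeroDivisors D :=
    powers_le_nonZeroDivisors_of_noZeroDivisors hy
  have : IsDomain L := IsLocalization.isDomain_localization hle
  have : Algebra.FiniteType D L := IsLocalization.finiteType_of_monoid_fg (Submonoid.powers y) L
  have : Algebra.FiniteType k L := .trans ‹_› this
  have : Ring.KrullDimLE 1 L := Ring.KrullDimLE.localization (Submonoid.powers y)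
  have htr := trdeg_le_one_of_krullDimLE k L
  let yL := algebraMap D L y
  let φ : L := IsLocalization.mk' L x ⟨y, Submonoid.mem_powers y⟩
  have hφ : φ * yL = algebraMap D L x := IsLocalization.mk'_spec L x ⟨y, Submonoid.mem_powers y⟩
  let K := FractionRing L
  have hinj := IsFractionRing.injective L K
  have hdep : ¬ AlgebraicIndependent k (algebraMap L K ∘ ![φ, yL]) := by
    intro h
    have h1 : AlgebraicIndependent k ![φ, yL] :=
      AlgebraicIndependent.of_comp (IsScalarTower.toAlgHom k L K) h
    have h2 := h1.lift_cardinalMk_le_trdeg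
    have h3 := h2.trans (Cardinal.lift_le.mpr htr)
    simp at h3
  obtain ⟨F, hF, hFa, i, hFi⟩ := exists_irreducible_relation p _ hdep
  have hFL : MvPolynomial.aeval ![φ, yL] F = 0 := by
    apply hinj
    rw [map_zero, ← hFa, MvPolynomial.aeval_algebraMap_apply]
  refine ⟨(setOf_pderiv_one_shear_eq_zero_subsingleton hFi).finite.toFinset, fun c hc ↦ ?_⟩
  have hc : MvPolynomial.pderiv 1 (shear c F) ≠ 0 := by simpa using hc
  obtain ⟨T, hT⟩ := exists_finset_separable
    (Q := shear c F) ((MulEquiv.irreducible_iff _).mpr hF) hc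
  refine ⟨T.image (- ·), fun t ht ↦ ?_⟩
  have hsep := hT (-t) (fun h ↦ ht (Finset.mem_image.mpr ⟨-t, h, neg_neg t⟩))
  let x' := x + c • y ^ 2 + t • y
  let E := D ⧸ Ideal.span {x'}
  have hyE : IsUnit (algebraMap D E y) := by
    obtain ⟨a, b, hab⟩ := hxy
    refine .of_mul_eq_one (Ideal.Quotient.mk _ (b - a * (c • y + t • 1))) ?_
    change Ideal.Quotient.mk _ y * _ = 1
    rw [← map_mul, ← map_one (Ideal.Quotient.mk _), Ideal.Quotient.mk_eq_mk_iff_sub_mem,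
      Ideal.mem_span_singleton]
    refine ⟨-a, ?_⟩
    simp only [x', Algebra.smul_def]
    linear_combination hab
  let ψ : L →ₐ[k] E := IsLocalization.liftAlgHom (M := Submonoid.powers y)
    (f := Ideal.Quotient.mkₐ k (Ideal.span {x'})) (by
      rintro ⟨_, n, rfl⟩
      rw [map_pow]
      exact hyE.pow n)
  have hψ (a : D) : ψ (algebraMap D L a) = algebraMap D E a :=
    IsLocalization.lift_eq _ a
  have hψφ : ψ (φ + c • yL) = algebraMap k E (-t) := by
    apply hyE.mul_left_injective
    change ψ _ * algebraMap D E y = _ * algebraMap D E y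
    rw [← hψ, ← map_mul, add_mul, hφ, hψ]
    have h0 : algebraMap D E x' = 0 := Ideal.Quotient.mk_singleton_self x'
    simp only [x', map_add, Algebra.smul_def, map_mul, map_pow, ← IsScalarTower.algebraMap_apply] at h0
    simp only [yL, map_add, Algebra.smul_def, map_mul, hψ, map_neg, AlgHom.commutes]
    linear_combination h0
  have hQ : MvPolynomial.aeval ![φ + c • yL, yL] (shear c F) = 0 := by
    rw [← hFL]
    have : (MvPolynomial.aeval ![φ + c • yL, yL]).comp (shear c).toAlgHom =
        (MvPolynomial.aeval ![φ, yL] : MvPolynomial (Fin 2) k →ₐ[k] L) := by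
      ext i
      fin_cases i <;> simp [shear, Algebra.smul_def]
    exact DFunLike.congr_fun this F
  have hQE : MvPolynomial.aeval ![algebraMap k E (-t), algebraMap D E y] (shear c F) = 0 := by
    have h1 := congrArg ψ hQ
    rw [map_zero, ← AlgHom.comp_apply, MvPolynomial.comp_aeval] at h1
    rw [← h1]
    congr 2
    ext i
    fin_cases i
    · exact hψφ.symm
    · exact (hψ y).symm
  rw [← aeval_map_equivMvPolynomial_symm] at hQE
  obtain ⟨Λ, h0, hΛ⟩ := hsep.exists_prod_eq_zero hQE hyE
  refine ⟨Λ, h0, ?_⟩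
  rw [← Ideal.mem_span_singleton, ← Ideal.Quotient.eq_zero_iff_mem, map_prod, ← hΛ]
  rfl

theorem finite_setOf_isPrime_mem {C : Type*} [CommRing C] [IsNoetherianRing C]
    [Ring.KrullDimLE 1 C] {e : C} (he : ∀ q ∈ minimalPrimes C, e ∉ q) :
    {Q : Ideal C | Q.IsPrime ∧ e ∈ Q}.Finite := by
  have : Ring.KrullDimLE 0 (C ⧸ Ideal.span {e}) := by
    refine Ring.KrullDimLE.quotient_of_not_le fun q hq hle ↦ he q hq ?_
    exact hle (Ideal.mem_span_singleton_self e)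
  have : IsArtinianRing (C ⧸ Ideal.span {e}) := isArtinianRing_iff_krullDimLE_zero.mpr this
  refine (Set.finite_range fun P : PrimeSpectrum (C ⧸ Ideal.span {e}) ↦
    P.asIdeal.comap (Ideal.Quotient.mk _)).subset ?_
  rintro Q ⟨hQ, heQ⟩
  have hle : Ideal.span {e} ≤ Q := (Ideal.span_singleton_le_iff_mem Q).mpr heQ
  have hker : RingHom.ker (Ideal.Quotient.mk (Ideal.span {e})) ≤ Q := by rwa [Ideal.mk_ker]
  refine ⟨⟨Q.map (Ideal.Quotient.mk _),
    Ideal.map_isPrime_of_surjective Ideal.Quotient.mk_surjective hker⟩, ?_⟩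
  dsimp only
  rw [Ideal.comap_map_of_surjective' _ Ideal.Quotient.mk_surjective, sup_eq_left]
  exact hker

theorem exists_dvd_prod_sub_of_isReduced (p : ℕ) [Fact p.Prime] (k : Type*) {C : Type*} [Field k]
    [CharP k p] [IsAlgClosed k] [CommRing C] [IsReduced C] [Algebra k C]
    [Algebra.FiniteType k C] [Ring.KrullDimLE 1 C] {Φ : Finset (Ideal C)} {u : Ideal C → C}
    (hu : IsSeparating Φ u) {x y : C} (hxy : IsCoprime x y) :
    ∃ (c t : k) (Λ : Finset k), (∀ P ∈ Φ, x + c • y ^ 2 + t • y ∉ P) ∧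
      IsCoprime (x + c • y ^ 2 + t • y) (∑ P ∈ Φ, u P) ∧ Λ.Nonempty ∧ 0 ∉ Λ ∧
      x + c • y ^ 2 + t • y ∣ ∏ l ∈ Λ, (y - algebraMap k C l) := by
  classical
  have hnoeth : IsNoetherianRing C := Algebra.FiniteType.isNoetherianRing k C
  have hdom (P : Ideal C) : ∃ T : Finset k, ∀ c ∉ T, ∃ T' : Finset k, ∀ t ∉ T', ∃ Λ : Finset k,
      P ∈ Φ → 0 ∉ Λ ∧ Ideal.Quotient.mk P (x + c • y ^ 2 + t • y) ∣
        Ideal.Quotient.mk P (∏ l ∈ Λ, (y - algebraMap k C l)) := by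
    by_cases hP : P ∈ Φ
    · have hPm := (hu.1 P).mp hP
      have : P.IsPrime := hPm.1.1
      have : Ring.KrullDimLE 1 (C ⧸ P) := Ring.KrullDimLE.quotient P
      obtain ⟨T, hT⟩ := exists_dvd_prod_sub_of_isDomain p k (hxy.map (Ideal.Quotient.mk P))
      refine ⟨T, fun c hc ↦ ?_⟩
      obtain ⟨T', hT'⟩ := hT c hc
      refine ⟨T', fun t ht ↦ ?_⟩
      obtain ⟨Λ, h0, hΛ⟩ := hT' t ht
      refine ⟨Λ, fun _ ↦ ⟨h0, ?_⟩⟩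
      rw [map_prod]
      exact hΛ
    · exact ⟨∅, fun _ _ ↦ ⟨∅, fun _ _ ↦ ⟨∅, fun h ↦ absurd h hP⟩⟩⟩
  choose T hT using hdom
  have hinf : Infinite k := IsAlgClosed.instInfinite
  obtain ⟨c, hc⟩ := Infinite.exists_notMem_finset (Φ.biUnion T)
  have hcT (P) (hP : P ∈ Φ) : c ∉ T P := fun h ↦ hc (Finset.mem_biUnion.mpr ⟨P, hP, h⟩)
  have hT2 (P : Ideal C) : ∃ T' : Finset k, ∀ t ∉ T', ∃ Λ : Finset k,
      P ∈ Φ → 0 ∉ Λ ∧ Ideal.Quotient.mk P (x + c • y ^ 2 + t • y) ∣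
        Ideal.Quotient.mk P (∏ l ∈ Λ, (y - algebraMap k C l)) := by
    by_cases hP : P ∈ Φ
    · exact hT P c (hcT P hP)
    · exact ⟨∅, fun _ _ ↦ ⟨∅, fun h ↦ absurd h hP⟩⟩
  choose T' hT' using hT2
  let S : Set (Ideal C) := (Φ : Set (Ideal C)) ∪ {Q | Q.IsPrime ∧ ∑ P ∈ Φ, u P ∈ Q}
  have hSfin : S.Finite := Φ.finite_toSet.union
    (finite_setOf_isPrime_mem fun q hq ↦ hu.sum_notMem ((hu.1 q).mpr hq))
  have hSprime (Q) (hQ : Q ∈ S) : Q.IsPrime :=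
    hQ.elim (fun h ↦ ((hu.1 Q).mp h).1.1) (fun h ↦ h.1)
  have hfin := finite_setOf_add_smul_mem (k := k) (x + c • y ^ 2) y hSfin fun Q hQ ↦ by
    have := hSprime Q hQ
    refine ⟨this, fun h1 h2 ↦ this.ne_top ?_⟩
    have hx : x ∈ Q := by
      refine (Submodule.add_mem_iff_left _ ?_).mp h1
      rw [Algebra.smul_def, sq]
      exact Q.mul_mem_left _ (Q.mul_mem_left _ h2)
    obtain ⟨a, b, hab⟩ := hxy
    rw [Ideal.eq_top_iff_one, ← hab]
    exact Q.add_mem (Q.mul_mem_left _ hx) (Q.mul_mem_left _ h2)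
  obtain ⟨t, ht⟩ := Infinite.exists_notMem_finset (Φ.biUnion T' ∪ hfin.toFinset)
  rw [Finset.notMem_union, Set.Finite.mem_toFinset] at ht
  set x' := x + c • y ^ 2 + t • y with hx'
  have hxS (Q) (hQ : Q ∈ S) : x' ∉ Q := fun h ↦ ht.2 ⟨Q, hQ, h⟩
  have hL (P : Ideal C) : ∃ Λ : Finset k, P ∈ Φ → 0 ∉ Λ ∧ Ideal.Quotient.mk P x' ∣
      Ideal.Quotient.mk P (∏ l ∈ Λ, (y - algebraMap k C l)) := by
    by_cases hP : P ∈ Φ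
    · exact hT' P t fun h ↦ ht.1 (Finset.mem_biUnion.mpr ⟨P, hP, h⟩)
    · exact ⟨∅, fun h ↦ absurd h hP⟩
  choose Λ hΛ using hL
  have hcop : IsCoprime x' (∑ P ∈ Φ, u P) := by
    rw [← Ideal.isCoprime_span_singleton_iff, Ideal.isCoprime_iff_sup_eq]
    by_contra hne
    obtain ⟨m, hm, hle⟩ := Ideal.exists_le_maximal _ hne
    rw [sup_le_iff, Ideal.span_singleton_le_iff_mem, Ideal.span_singleton_le_iff_mem] at hle
    exact hxS m (.inr ⟨hm.isPrime, hle.2⟩) hle.1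
  let Λ' := insert 1 (Φ.biUnion Λ)
  refine ⟨c, t, Λ', fun P hP ↦ hxS P (.inl hP), hcop, Finset.insert_nonempty _ _, ?_, ?_⟩
  · simp only [Λ', Finset.mem_insert, zero_ne_one, Finset.mem_biUnion, false_or, not_exists, not_and]
    exact fun P hP ↦ (hΛ P hP).1
  · refine hcop.dvd_of_dvd_mul_left ?_
    rw [Finset.sum_mul]
    refine Finset.dvd_sum fun P hP ↦ ?_
    have hsub : Λ P ⊆ Λ' :=
      (Finset.subset_biUnion_of_mem Λ hP).trans (Finset.subset_insert _ _)
    obtain ⟨g, hg⟩ := (hΛ P hP).2.trans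
      (map_dvd _ (Finset.prod_dvd_prod_of_subset _ _ (fun l ↦ y - algebraMap k C l) hsub))
    obtain ⟨g, rfl⟩ := Ideal.Quotient.mk_surjective g
    rw [← map_mul, Ideal.Quotient.mk_eq_mk_iff_sub_mem] at hg
    rw [hu.mul_eq_mul hP hg]
    exact ⟨u P * g, mul_left_comm _ _ _⟩

section Factor

open Ideal

theorem isCoprime_span_pair_sub_algebraMap {k C : Type*} [Field k] [CommRing C] [Algebra k C]
    (x y : C) {a b : k} (h : a ≠ b) :
    IsCoprime (span {x, y - algebraMap k C a}) (span {x, y - algebraMap k C b}) := by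
  rw [isCoprime_iff_sup_eq, eq_top_iff_one]
  have h1 : algebraMap k C (a - b)⁻¹ * ((y - algebraMap k C b) - (y - algebraMap k C a)) = 1 := by
    rw [sub_sub_sub_cancel_left, ← map_sub, ← map_mul, inv_mul_cancel₀ (sub_ne_zero.mpr h), map_one]
  rw [← h1]
  refine mul_mem_left _ _ (sub_mem (mem_sup_right ?_) (mem_sup_left ?_)) <;>
  exact subset_span (by simp)

theorem prod_span_pair_sub_algebraMap {k C : Type*} [Field k] [CommRing C] [Algebra k C]
    {x y : C} {Λ : Finset k} (h : x ∣ ∏ l ∈ Λ, (y - algebraMap k C l)) :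
    ∏ l ∈ Λ, span {x, y - algebraMap k C l} = span {x} ∧
      ∀ z, (∀ l ∈ Λ, z ∈ span {x, y - algebraMap k C l}) → z ∈ span {x} := by
  classical
  have hinf : ∏ l ∈ Λ, span {x, y - algebraMap k C l} = ⨅ l ∈ Λ, span {x, y - algebraMap k C l} :=
    prod_eq_iInf_of_pairwise_isCoprime fun a _ b _ hab ↦ isCoprime_span_pair_sub_algebraMap x y hab
  have hle : ∀ Λ : Finset k, ∏ l ∈ Λ, span {x, y - algebraMap k C l} ≤
      span {x, ∏ l ∈ Λ, (y - algebraMap k C l)} := by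
    intro Λ
    induction Λ using Finset.induction_on with
    | empty => simp [span_insert]
    | insert a s ha ih =>
      rw [Finset.prod_insert ha, Finset.prod_insert ha]
      refine (mul_mono_right ih).trans ?_
      rw [span_pair_mul_span_pair, span_le]
      have hx : x ∈ span {x, (y - algebraMap k C a) * ∏ l ∈ s, (y - algebraMap k C l)} :=
        subset_span (by simp)
      simp only [Set.insert_subset_iff, Set.singleton_subset_iff, SetLike.mem_coe]
      exact ⟨mul_mem_left _ _ hx, mul_mem_right _ _ hx, mul_mem_left _ _ hx, subset_span (by simp)⟩
  have hmain : ∏ l ∈ Λ, span {x, y - algebraMap k C l} = span {x} := by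
    refine le_antisymm ((hle Λ).trans ?_) ?_
    · rw [span_le, Set.insert_subset_iff, Set.singleton_subset_iff]
      exact ⟨mem_span_singleton_self x, mem_span_singleton.mpr h⟩
    · rw [hinf, span_singleton_le_iff_mem]
      simp only [mem_iInf]
      exact fun l _ ↦ subset_span (by simp)
  refine ⟨hmain, fun z hz ↦ ?_⟩
  rw [← hmain, hinf]
  simpa only [mem_iInf] using hz

theorem exists_prod_eq_pow (p : ℕ) [Fact p.Prime] (k : Type*) {C : Type*} [Field k]
    [Algebra (ZMod p) k] [Algebra.IsIntegral (ZMod p) k] [CommRing C] [IsReduced C] [Algebra k C]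
    [Algebra.FiniteType k C] [Ring.KrullDimLE 1 C] {Φ : Finset (Ideal C)} {u : Ideal C → C}
    (hu : IsSeparating Φ u) {x y : C} (hx : ∀ P ∈ Φ, x ∉ P) (hxu : IsCoprime x (∑ P ∈ Φ, u P))
    {Λ : Finset k} (hΛ : Λ.Nonempty) (h : x ∣ ∏ l ∈ Λ, (y - algebraMap k C l)) :
    ∃ N, N ≠ 0 ∧ ∃ f : k → C, (∀ l ∈ Λ, span {x, y - algebraMap k C l} ^ N = span {f l}) ∧
      ∏ l ∈ Λ, f l = x ^ N := by
  classical
  have hq := (prod_span_pair_sub_algebraMap h).1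
  obtain ⟨N, hN, hP⟩ := exists_common_pow Λ
    (P := fun l N ↦ ∃ f, span {x, y - algebraMap k C l} ^ N = span {f})
    (fun l hl ↦ exists_pow_eq_span_of_isReduced p k hu hx hxu
      (q' := ∏ m ∈ Λ.erase l, span {x, y - algebraMap k C m})
      (by rw [Finset.mul_prod_erase Λ (fun m ↦ span {x, y - algebraMap k C m}) hl, hq]))
    (fun l M N _ ⟨f, hf⟩ ↦ ⟨f ^ N, by rw [pow_mul, hf, span_singleton_pow]⟩)
  have hP' (l : k) : ∃ f, l ∈ Λ → span {x, y - algebraMap k C l} ^ N = span {f} := by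
    by_cases hl : l ∈ Λ
    · obtain ⟨f, hf⟩ := hP l hl
      exact ⟨f, fun _ ↦ hf⟩
    · exact ⟨0, fun h ↦ absurd h hl⟩
  choose f hf using hP'
  have hspan : span {∏ l ∈ Λ, f l} = span {x ^ N} := by
    rw [← span_singleton_pow, ← hq, ← Finset.prod_pow, Finset.prod_congr rfl hf,
      prod_span_singleton]
  obtain ⟨a, ha⟩ := mem_span_singleton'.mp (hspan.le (mem_span_singleton_self _))
  obtain ⟨b, hb⟩ := mem_span_singleton'.mp (hspan.ge (mem_span_singleton_self _))
  have hba : b * a = 1 := by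
    have h0 : x ^ N * (b * a - 1) = 0 := by linear_combination hb + b * ha
    rw [← sub_eq_zero, ← Ideal.mem_bot, ← nilradical_eq_bot_iff.mpr ‹_›, nilradical,
      ← sInf_minimalPrimes, mem_sInf]
    intro P hP
    have := hP.1.1
    refine (this.mem_or_mem (h0 ▸ P.zero_mem : x ^ N * (b * a - 1) ∈ P)).resolve_left fun h ↦ ?_
    exact hx P ((hu.1 P).mpr hP) (this.mem_of_pow_mem _ h)
  obtain ⟨l₀, hl₀⟩ := hΛ
  refine ⟨N, hN, fun l ↦ if l = l₀ then b * f l else f l, fun l hl ↦ ?_, ?_⟩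
  · rw [hf l hl]
    dsimp only
    split_ifs with h
    · rw [← span_singleton_mul_left_unit (.of_mul_eq_one _ hba)]
    · rfl
  · rw [← hb, ← Finset.mul_prod_erase _ _ hl₀, ← Finset.mul_prod_erase _ _ hl₀, if_pos rfl, mul_assoc]
    congr 2
    refine Finset.prod_congr rfl fun l hl ↦ if_neg (Finset.ne_of_mem_erase hl)

end Factor

section UnimodularRow

open Ideal

theorem exists_sub_algebraMap_mem_span {k R : Type*} [CommRing k] [CommRing R]
    [Algebra k R] {Λ : Finset k} {F : k → R} (μ : k → k)
    (hF : ∀ i ∈ Λ, ∀ j ∈ Λ, i ≠ j → IsCoprime (F i) (F j)) :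
    ∃ Z : R, ∀ l ∈ Λ, Z - algebraMap k R (μ l) ∈ span {F l} := by
  obtain ⟨Z, hZ⟩ := pi_quotient_surjective (I := fun l : Λ ↦ span {F l}) (fun i j hij ↦
    (isCoprime_span_singleton_iff _ _).mpr (hF i i.2 j j.2 (Subtype.coe_injective.ne hij)))
    (fun l ↦ Ideal.Quotient.mk _ (algebraMap k R (μ l)))
  exact ⟨Z, fun l hl ↦ Ideal.Quotient.mk_eq_mk_iff_sub_mem _ _ |>.mp (hZ ⟨l, hl⟩)⟩

theorem Elem.of_krullDimLE_two (p : ℕ) [Fact p.Prime] (k : Type*) {R : Type*} [Field k]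
    [Algebra (ZMod p) k] [Algebra.IsIntegral (ZMod p) k] [IsAlgClosed k] [CommRing R]
    [Algebra k R] [Algebra.FiniteType k R] [Ring.KrullDimLE 2 R] {c x y : R}
    (hc : ∀ q ∈ minimalPrimes R, c ∉ q) (h : span {c, x, y} = ⊤) :
    Elem ![c, x, y] (Pi.single 0 1) := by
  classical
  have : CharP k p := charP_of_injective_algebraMap (algebraMap (ZMod p) k).injective p
  have range_eq (a b c : R) : Set.range ![a, b, c] = {a, b, c} := by
    rw [Matrix.range_cons, Matrix.range_cons_cons_empty, Set.singleton_union]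
  let I := (span {c}).radical
  let C := R ⧸ I
  let π : R →+* C := Ideal.Quotient.mk I
  have hπ : Function.Surjective π := Ideal.Quotient.mk_surjective
  have hIc : π c = 0 :=
    Ideal.Quotient.eq_zero_iff_mem.mpr (le_radical (mem_span_singleton_self c))
  have hπI {a b : R} (hab : π a = π b) : a - b ∈ I := (Ideal.Quotient.mk_eq_mk_iff_sub_mem a b).mp hab
  have : IsReduced C := (isRadical_iff_quotient_reduced I).mp (radical_isRadical _)
  have : Ring.KrullDimLE 1 C := Ring.KrullDimLE.quotient_of_not_le fun q hq hle ↦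
    hc q hq (hle (le_radical (mem_span_singleton_self c)))
  have hxy : IsCoprime (π x) (π y) := by
    have h1 : (1 : R) ∈ span {c, x, y} := h ▸ Submodule.mem_top
    obtain ⟨a, z, hz, h1⟩ := mem_span_insert.mp h1
    obtain ⟨b, d, rfl⟩ := mem_span_pair.mp hz
    refine ⟨π b, π d, ?_⟩
    have h2 := congrArg π h1
    rw [map_add, map_mul, hIc, mul_zero, zero_add, map_add, map_mul, map_mul, map_one] at h2
    exact h2.symm
  have : IsNoetherianRing C := Algebra.FiniteType.isNoetherianRing k C
  obtain ⟨Φ, u, hu⟩ := exists_isSeparating C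
  obtain ⟨c₀, t, Λ, hx1, hx1u, hΛ, hΛ0, hdvd⟩ := exists_dvd_prod_sub_of_isReduced p k hu hxy
  let x' := x + c₀ • y ^ 2 + t • y
  have hx' : π x' = π x + c₀ • π y ^ 2 + t • π y := rfl
  rw [← hx'] at hx1 hx1u hdvd
  obtain ⟨N, hN, f, hf, hfprod⟩ := exists_prod_eq_pow p k hu hx1 hx1u hΛ hdvd
  have hfP (l) (hl : l ∈ Λ) (P) (hP : P ∈ minimalPrimes C) : f l ∉ P := fun hfl ↦ by
    have := hP.1.1
    refine hx1 P ((hu.1 P).mpr hP) (this.mem_of_pow_mem N ?_)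
    rw [← hfprod]
    exact P.prod_mem hl hfl
  obtain ⟨Q, hQ, F, hF, hFcop⟩ := exists_lift_pairwise_isCoprime π hπ f Λ fun i hi j hj hij Q ↦ by
    refine exists_dvd_pow_sub_one p k (fun q hq h ↦ hfP j hj q hq (hq.1.1.mem_of_pow_mem _ h)) ?_
    have hcop : IsCoprime (f i) (f j) := by
      rw [← isCoprime_span_singleton_iff, ← hf i hi, ← hf j hj]
      exact (isCoprime_span_pair_sub_algebraMap _ _ hij).pow
    exact hcop.pow_right
  have hNQ : 0 < N * Q := Nat.pos_of_ne_zero (mul_ne_zero hN hQ)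
  choose μ hμ using fun l : k ↦ IsAlgClosed.exists_pow_nat_eq l hNQ
  obtain ⟨Z, hZ⟩ := exists_sub_algebraMap_mem_span μ hFcop
  have hZF : IsCoprime (∏ l ∈ Λ, F l) Z := by
    refine IsCoprime.prod_left fun l hl ↦ ?_
    have hμ0 : μ l ≠ 0 := by
      rintro h0
      rw [← hμ l, h0, zero_pow hNQ.ne'] at hl
      exact hΛ0 hl
    obtain ⟨a, ha⟩ := mem_span_singleton'.mp (hZ l hl)
    refine ⟨-(algebraMap k R (μ l)⁻¹ * a), algebraMap k R (μ l)⁻¹, ?_⟩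
    have : algebraMap k R (μ l)⁻¹ * algebraMap k R (μ l) = 1 := by
      rw [← map_mul, inv_mul_cancel₀ hμ0, map_one]
    linear_combination this - algebraMap k R (μ l)⁻¹ * ha
  have hZy : π Z ^ (N * Q) - π y ∈ span {π x'} := by
    refine (prod_span_pair_sub_algebraMap hdvd).2 _ fun l hl ↦ ?_
    have h1 : π Z - algebraMap k C (μ l) ∈ span {π x', π y - algebraMap k C l} := by
      obtain ⟨a, ha⟩ := mem_span_singleton'.mp (hZ l hl)
      have h2 : π Z - algebraMap k C (μ l) = π a * f l ^ Q := by
        rw [← hF l hl, ← map_mul, ha, map_sub]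
        rfl
      rw [h2]
      refine mul_mem_left _ _ (pow_mem_of_mem _ ?_ Q (Nat.pos_of_ne_zero hQ))
      refine pow_le_self hN ?_
      rw [hf l hl]
      exact mem_span_singleton_self _
    obtain ⟨d, hd⟩ := sub_dvd_pow_sub_pow (π Z) (algebraMap k C (μ l)) (N * Q)
    have h3 : π Z ^ (N * Q) - π y = (π Z - algebraMap k C (μ l)) * d - (π y - algebraMap k C l) := by
      rw [← hd, ← map_pow (algebraMap k C), hμ, sub_sub_sub_cancel_right]
    rw [h3]
    exact sub_mem (mul_mem_right _ _ h1) (subset_span (by simp))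
  obtain ⟨b, hb⟩ := mem_span_singleton'.mp hZy
  obtain ⟨b, rfl⟩ := hπ b
  have s1 : Elem ![c, x, y] ![c, x', y] := .cons c (.of_pair' rfl (c₀ • y + t • 1) (by
    simp only [x', Algebra.smul_def]; ring))
  have s2 : Elem ![c, x', y] ![c, x', y + b * x'] := .cons c (.of_pair rfl b rfl)
  have e12 := s1.trans s2
  have top12 : span {c, x', y + b * x'} = ⊤ := by
    rw [← h, ← range_eq, ← range_eq, e12.span_eq]
  have s3 : Elem ![c, x', y + b * x'] ![c, x', Z ^ (N * Q)] := by
    refine .of_mem_radical top12 (by simp) (hπI ?_)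
    rw [map_pow, map_add, map_mul, hb, add_sub_cancel]
  have top3 : span {c, x', Z} = ⊤ := by
    rw [eq_top_iff, ← top12, ← range_eq, s3.span_eq, range_eq, span_le]
    rintro _ (rfl | rfl | rfl)
    · exact subset_span (by simp)
    · exact subset_span (by simp)
    · exact pow_mem_of_mem _ (subset_span (by simp)) _ hNQ
  have s4 : Elem ![c, x', Z ^ (N * Q)] ![c, x' ^ (N * Q), Z] := .pow_swap top3 _
  have s5 : Elem ![c, x' ^ (N * Q), Z] ![c, ∏ l ∈ Λ, F l, Z] := by
    refine .of_mem_radical ?_ (hπI ?_) (by simp)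
    · rw [← h, ← range_eq, ← range_eq, (e12.trans (s3.trans s4)).span_eq]
    · rw [map_prod, Finset.prod_congr rfl hF, Finset.prod_pow, hfprod, map_pow, pow_mul]
  refine e12.trans (s3.trans (s4.trans (s5.trans (.of_span_eq_top (i := 0) ?_ 0))))
  have himg : {∏ l ∈ Λ, F l, Z} ⊆ ![c, ∏ l ∈ Λ, F l, Z] '' {j | j ≠ 0} := by
    rintro _ (rfl | rfl)
    · exact ⟨1, by simp, rfl⟩
    · exact ⟨2, by simp, rfl⟩
  rw [eq_top_iff]
  refine le_trans ?_ (span_mono himg)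
  rw [span_insert, ← isCoprime_iff_sup_eq.mp ((isCoprime_span_singleton_iff _ _).mpr hZF)]

theorem exists_elem_cons (k : Type*) {R : Type*} [Field k] [Infinite k] [CommRing R]
    [IsNoetherianRing R] [Algebra k R] {n : ℕ} {v : Fin (n + 1) → R}
    (hv : span (Set.range v) = ⊤) :
    ∃ c, (∀ q ∈ minimalPrimes R, c ∉ q) ∧ Elem v (Fin.cons c (Fin.tail v)) := by
  classical
  have hfin := finite_setOf_sum_pow_smul_mem (k := k) v (minimalPrimes.finite_of_isNoetherianRing R)
    fun q hq ↦ by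
      have : q.IsPrime := hq.1.1
      refine ⟨this, ?_⟩
      by_contra! hall
      refine this.ne_top (top_le_iff.mp (hv ▸ span_le.mpr ?_))
      rintro _ ⟨i, rfl⟩
      exact hall i
  obtain ⟨s, hs⟩ := Infinite.exists_notMem_finset hfin.toFinset
  rw [Set.Finite.mem_toFinset] at hs
  refine ⟨∑ i : Fin (n + 1), s ^ (i : ℕ) • v i, fun q hq h ↦ hs ⟨q, hq, h⟩, ?_⟩
  have h1 := Elem.update_add_sum v (fun i ↦ algebraMap k R (s ^ (i : ℕ))) 0
    (Finset.univ.erase 0) (by simp)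
  convert h1 using 1
  rw [← Fin.update_cons_zero (v 0), Fin.cons_self_tail]
  congr 1
  rw [← Finset.add_sum_erase _ _ (Finset.mem_univ 0)]
  simp [Algebra.smul_def]

theorem Elem.of_krullDimLE (p : ℕ) [Fact p.Prime] (k : Type*) [Field k]
    [Algebra (ZMod p) k] [Algebra.IsIntegral (ZMod p) k] [IsAlgClosed k] (n : ℕ) :
    ∀ (R : Type*) [CommRing R] [Algebra k R] [Algebra.FiniteType k R] [Ring.KrullDimLE (n + 2) R]
      (v : Fin (n + 3) → R), span (Set.range v) = ⊤ → Elem v (Pi.single 0 1) := by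
  classical
  have hinf : Infinite k := IsAlgClosed.instInfinite
  induction n with
  | zero =>
    intro R _ _ _ _ v hv
    have : IsNoetherianRing R := Algebra.FiniteType.isNoetherianRing k R
    obtain ⟨c, hc, h⟩ := exists_elem_cons k hv
    refine h.trans ?_
    have hw : (Fin.cons c (Fin.tail v) : Fin 3 → R) = ![c, v 1, v 2] := by
      ext i
      fin_cases i <;> rfl
    rw [hw] at h ⊢
    refine Elem.of_krullDimLE_two p k hc ?_
    rw [← hv, h.span_eq, Matrix.range_cons, Matrix.range_cons_cons_empty, Set.singleton_union]
  | succ n ih =>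
    intro R _ _ _ _ v hv
    have : IsNoetherianRing R := Algebra.FiniteType.isNoetherianRing k R
    obtain ⟨c, hc, h⟩ := exists_elem_cons k hv
    refine h.trans ?_
    have : Ring.KrullDimLE (n + 2) (R ⧸ span {c}) := Ring.KrullDimLE.quotient_of_not_le
      fun q hq hle ↦ hc q hq (hle (mem_span_singleton_self c))
    have htop : span (Set.range (Ideal.Quotient.mk (span {c}) ∘ Fin.tail v)) = ⊤ := by
      rw [h.span_eq, Fin.range_cons, span_insert] at hv
      have h1 := congrArg (Ideal.map (Ideal.Quotient.mk (span {c}))) hv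
      rwa [Ideal.map_sup, map_quotient_self, bot_sup_eq, Ideal.map_top, map_span, ← Set.range_comp] at h1
    have h1 : Elem (Ideal.Quotient.mk (span {c}) ∘ Fin.tail v)
        (Ideal.Quotient.mk (span {c}) ∘ Pi.single 0 1) := by
      convert ih (R ⧸ span {c}) _ htop using 1
      ext i
      by_cases hi : i = 0 <;> simp [hi]
    exact (Elem.cons_of_quotient h1).trans (.of_eq_one (i := 1) (by simp [Fin.cons_one]) 0)

end UnimodularRow

section FreeUpTo

/-- Multiplication by `s` on `Aʳ` and on `P` factors through the other module. -/
def IsFreeUpTo {A : Type*} [CommRing A] (r : ℕ) (P : Type*) [AddCommGroup P] [Module A P]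
    (s : A) : Prop :=
  ∃ (α : (Fin r → A) →ₗ[A] P) (β : P →ₗ[A] (Fin r → A)),
    (∀ x, α (β x) = s • x) ∧ ∀ f, β (α f) = s • f

/-- `P` is free of rank `r` up to some `s` outside all minimal primes, and up to each of a family
of elements generating the unit ideal. -/
def HasFreeCover (A : Type*) [CommRing A] (r : ℕ) (P : Type*) [AddCommGroup P]
    [Module A P] : Prop :=
  (∃ s : A, IsFreeUpTo r P s ∧ ∀ q ∈ minimalPrimes A, s ∉ q) ∧
    Ideal.span {s : A | IsFreeUpTo r P s} = ⊤

variable {A : Type*} [CommRing A] {r : ℕ} {P Q : Type*} [AddCommGroup P] [Module A P]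
  [AddCommGroup Q] [Module A Q]

theorem IsFreeUpTo.congr {s : A} (h : IsFreeUpTo r P s) (e : P ≃ₗ[A] Q) : IsFreeUpTo r Q s := by
  obtain ⟨α, β, h₁, h₂⟩ := h
  refine ⟨e.toLinearMap ∘ₗ α, β ∘ₗ e.symm.toLinearMap, fun x ↦ ?_, fun f ↦ ?_⟩
  · simp [h₁]
  · simp [h₂]

theorem IsFreeUpTo.exists_prod {s : A} (h : IsFreeUpTo r P s) :
    ∃ (α : (Fin (r + 1) → A) →ₗ[A] A × P) (β : A × P →ₗ[A] (Fin (r + 1) → A)),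
      (∀ x, α (β x) = s • x) ∧ (∀ f, β (α f) = s • f) ∧ α (Pi.single 0 1) = (1, 0) := by
  obtain ⟨α, β, h₁, h₂⟩ := h
  let α' : (Fin (r + 1) → A) →ₗ[A] A × P :=
    (LinearMap.proj 0).prod (α ∘ₗ LinearMap.funLeft A A Fin.succ)
  let β' : A × P →ₗ[A] (Fin (r + 1) → A) := LinearMap.pi
    (Fin.cons (s • LinearMap.fst A A P) fun i ↦ LinearMap.proj i ∘ₗ β ∘ₗ LinearMap.snd A A P)
  have hβ (x : A × P) : β' x = Fin.cons (s * x.1) (β x.2) := by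
    funext i
    cases i using Fin.cases <;> simp [β']
  have hα (f : Fin (r + 1) → A) : α' f = (f 0, α (Fin.tail f)) := rfl
  refine ⟨α', β', fun x ↦ ?_, fun f ↦ ?_, ?_⟩
  · rw [hβ, hα]
    ext <;> simp [h₁]
  · rw [hβ, hα]
    funext i
    cases i using Fin.cases <;> simp [h₂, Fin.tail]
  · have : Fin.tail (Pi.single 0 1 : Fin (r + 1) → A) = 0 := by
      funext i
      simp [Fin.tail]
    rw [hα, this]
    simp

theorem HasFreeCover.congr (h : HasFreeCover A r P) (e : P ≃ₗ[A] Q) : HasFreeCover A r Q := by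
  obtain ⟨⟨s, hs, hsq⟩, hspan⟩ := h
  refine ⟨⟨s, hs.congr e, hsq⟩, top_le_iff.mp (hspan.ge.trans (Ideal.span_mono ?_))⟩
  exact fun t ht ↦ IsFreeUpTo.congr ht e

theorem HasFreeCover.prod (h : HasFreeCover A r P) : HasFreeCover A (r + 1) (A × P) := by
  have key {s : A} (hs : IsFreeUpTo r P s) : IsFreeUpTo (r + 1) (A × P) s := by
    obtain ⟨α, β, h₁, h₂, -⟩ := hs.exists_prod
    exact ⟨α, β, h₁, h₂⟩
  obtain ⟨⟨s, hs, hsq⟩, hspan⟩ := h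
  refine ⟨⟨s, key hs, hsq⟩, top_le_iff.mp (hspan.ge.trans (Ideal.span_mono ?_))⟩
  exact fun t ht ↦ key ht

theorem exists_isFreeUpTo_notMem [Module.Finite A P] [Module.Projective A P]
    (q : PrimeSpectrum A) (hq : Module.rankAtStalk P q = r) :
    ∃ s ∉ q.asIdeal, IsFreeUpTo r P s := by
  let S := q.asIdeal.primeCompl
  let B := Localization.AtPrime q.asIdeal
  let PB := LocalizedModule S P
  have : Module.Free B PB := Module.free_of_flat_of_isLocalRing
  have hrank : Module.finrank B PB = r := hq
  let e : PB ≃ₗ[B] (Fin r → B) := (Module.finBasisOfFinrankEq B PB hrank).equivFun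
  let e' : PB ≃ₗ[A] (Fin r → B) := e.restrictScalars A
  let f : P →ₗ[A] PB := LocalizedModule.mkLinearMap S P
  let g : (Fin r → A) →ₗ[A] (Fin r → B) :=
    LinearMap.pi fun i ↦ Algebra.linearMap A B ∘ₗ LinearMap.proj i
  have : Module.FinitePresentation A P := Module.finitePresentation_of_projective A P
  obtain ⟨α, u, hα⟩ := Module.FinitePresentation.exists_lift_of_isLocalizedModule S f
    (e'.symm.toLinearMap ∘ₗ g)
  obtain ⟨β, w, hβ⟩ := Module.FinitePresentation.exists_lift_of_isLocalizedModule S g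
    (e'.toLinearMap ∘ₗ f)
  have hα' (x) : f (α x) = u • e'.symm (g x) := congr($hα x)
  have hβ' (x) : g (β x) = w • e' (f x) := congr($hβ x)
  have h₁ : f ∘ₗ (α ∘ₗ β) = f ∘ₗ ((u * w) • LinearMap.id) := by
    ext x
    simp [hα', hβ', smul_smul, Submonoid.smul_def]
  have h₂ : g ∘ₗ (β ∘ₗ α) = g ∘ₗ ((u * w) • LinearMap.id) := by
    refine LinearMap.ext fun x ↦ ?_
    simp only [LinearMap.comp_apply, hα', hβ', Submonoid.smul_def, map_smul, smul_smul,
      LinearMap.smul_apply, LinearMap.id_apply, LinearEquiv.apply_symm_apply]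
    simp [mul_comm]
  obtain ⟨t, ht⟩ := Module.Finite.exists_smul_of_comp_eq_of_isLocalizedModule S f _ _ h₁
  obtain ⟨t', ht'⟩ := Module.Finite.exists_smul_of_comp_eq_of_isLocalizedModule S g _ _ h₂
  refine ⟨(t * t' * (u * w) : S), (t * t' * (u * w) : S).2, α, (t * t') • β, fun x ↦ ?_,
    fun x ↦ ?_⟩
  · have := congr(t' • $ht x)
    simp only [LinearMap.smul_apply, LinearMap.comp_apply, Submonoid.smul_def, smul_smul,
      LinearMap.id_apply, map_smul] at this ⊢
    convert this using 2 <;> simp [mul_comm, mul_left_comm]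
  · have := congr(t • $ht' x)
    simp only [LinearMap.smul_apply, LinearMap.comp_apply, Submonoid.smul_def, smul_smul,
      LinearMap.id_apply] at this ⊢
    convert this using 2 <;> simp [mul_comm, mul_left_comm]

theorem IsSeparating.exists_mul_eq_zero [IsNoetherianRing A] :
    ∃ (Φ : Finset (Ideal A)) (u : Ideal A → A), IsSeparating Φ u ∧
      ∀ P ∈ Φ, ∀ Q ∈ Φ, P ≠ Q → u P * u Q = 0 := by
  obtain ⟨Φ, u, hΦ, hu⟩ := exists_isSeparating A
  obtain ⟨N, hN⟩ := IsNoetherianRing.isNilpotent_nilradical A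
  have hprime {P : Ideal A} (hP : P ∈ Φ) : P.IsPrime := ((hΦ P).mp hP).1.1
  refine ⟨Φ, fun P ↦ u P ^ (N + 1), ⟨hΦ, fun P hP ↦ ⟨fun h ↦ (hu P hP).1
    ((hprime hP).mem_of_pow_mem _ h), fun Q hQ hne ↦ ?_⟩⟩, fun P hP Q hQ hne ↦ ?_⟩
  · exact Ideal.pow_mem_of_mem _ ((hu P hP).2 Q hQ hne) _ N.succ_pos
  · have : u P * u Q ∈ nilradical A := by
      rw [nilradical, ← Ideal.sInf_minimalPrimes, Ideal.mem_sInf]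
      intro q hq
      replace hq : q ∈ Φ := (hΦ q).mpr hq
      by_cases h : q = P
      · subst h
        exact q.mul_mem_left _ ((hu Q hQ).2 q hq hne)
      · exact q.mul_mem_right _ ((hu P hP).2 q hq h)
    have := Ideal.pow_mem_pow this N
    rw [hN] at this
    rw [← mul_pow, pow_succ, show (u P * u Q) ^ N = 0 from this, zero_mul]

theorem hasFreeCover_of_rankAtStalk [IsNoetherianRing A] [Module.Finite A P]
    [Module.Projective A P] (h : ∀ q : PrimeSpectrum A, Module.rankAtStalk P q = r) :
    HasFreeCover A r P := by
  classical
  constructor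
  · obtain ⟨Φ, u, hu, hmul⟩ := IsSeparating.exists_mul_eq_zero (A := A)
    have hprime {q : Ideal A} (hq : q ∈ Φ) : q.IsPrime := ((hu.1 q).mp hq).1.1
    have (q : Ideal A) : ∃ (s : A) (α : (Fin r → A) →ₗ[A] P) (β : P →ₗ[A] (Fin r → A)),
        (q ∈ Φ → s ∉ q) ∧ (∀ x, α (β x) = s • x) ∧ ∀ f, β (α f) = s • f := by
      by_cases hq : q ∈ Φ
      · obtain ⟨s, hs, α, β, h'⟩ := exists_isFreeUpTo_notMem ⟨q, hprime hq⟩ (h _)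
        exact ⟨s, α, β, fun _ ↦ hs, h'⟩
      · exact ⟨0, 0, 0, fun h ↦ absurd h hq, by simp, by simp⟩
    choose s α β hs hαβ hβα using this
    refine ⟨∑ q ∈ Φ, u q * (u q * s q), ⟨∑ q ∈ Φ, u q • α q, ∑ q ∈ Φ, u q • β q, fun x ↦ ?_,
      fun f ↦ ?_⟩, fun q hq hmem ↦ ?_⟩
    · simp only [LinearMap.sum_apply, LinearMap.smul_apply, map_sum, map_smul, Finset.sum_smul]
      refine Finset.sum_congr rfl fun q hq ↦ ?_
      rw [Finset.smul_sum, Finset.sum_eq_single_of_mem q hq fun q' hq' hne ↦ ?_]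
      · rw [hαβ, smul_smul, smul_smul, mul_assoc]
      · rw [smul_smul, hmul _ hq _ hq' hne.symm, zero_smul]
    · simp only [LinearMap.sum_apply, LinearMap.smul_apply, map_sum, map_smul, Finset.sum_smul]
      refine Finset.sum_congr rfl fun q hq ↦ ?_
      rw [Finset.smul_sum, Finset.sum_eq_single_of_mem q hq fun q' hq' hne ↦ ?_]
      · rw [hβα, smul_smul, smul_smul, mul_assoc]
      · rw [smul_smul, hmul _ hq _ hq' hne.symm, zero_smul]
    · replace hq := (hu.1 q).mpr hq
      have h₁ := hu.sum_mul_sub_mem hq fun q ↦ u q * s q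
      have := hprime hq
      rw [sub_mem_comm_iff, q.sub_mem_iff_left hmem] at h₁
      exact this.mul_notMem (hu.2 q hq).1 (this.mul_notMem (hu.2 q hq).1 (hs q hq)) h₁
  · by_contra hne
    obtain ⟨q, hq, hle⟩ := Ideal.exists_le_maximal _ hne
    obtain ⟨s, hs, hs'⟩ := exists_isFreeUpTo_notMem ⟨q, hq.isPrime⟩ (h _)
    exact hs (hle (Ideal.subset_span hs'))

end FreeUpTo

section QuadraticParts

variable {A : Type*} [CommRing A] {s : A} {ι : Type*}

open QuadraticAlgebra

/-- The real part of an endomorphism of a free module over a quadratic algebra, restricted to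
vectors with entries in the base ring. -/
def reMap (M : (ι → QuadraticAlgebra A 0 s) →ₗ[QuadraticAlgebra A 0 s]
    (ι → QuadraticAlgebra A 0 s)) : (ι → A) →ₗ[A] (ι → A) :=
  (LinearMap.compLeft (reₗ 0 s) ι) ∘ₗ M.restrictScalars A ∘ₗ
    LinearMap.compLeft (Algebra.linearMap A (QuadraticAlgebra A 0 s)) ι

/-- The imaginary part of an endomorphism of a free module over a quadratic algebra, restricted to
vectors with entries in the base ring. -/
def imMap (M : (ι → QuadraticAlgebra A 0 s) →ₗ[QuadraticAlgebra A 0 s]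
    (ι → QuadraticAlgebra A 0 s)) : (ι → A) →ₗ[A] (ι → A) :=
  (LinearMap.compLeft (imₗ 0 s) ι) ∘ₗ M.restrictScalars A ∘ₗ
    LinearMap.compLeft (Algebra.linearMap A (QuadraticAlgebra A 0 s)) ι

variable (M M' : (ι → QuadraticAlgebra A 0 s) →ₗ[QuadraticAlgebra A 0 s]
    (ι → QuadraticAlgebra A 0 s))

theorem reMap_apply (f : ι → A) (i : ι) :
    reMap M f i = (M (fun j ↦ algebraMap A _ (f j)) i).re := rfl

theorem imMap_apply (f : ι → A) (i : ι) :
    imMap M f i = (M (fun j ↦ algebraMap A _ (f j)) i).im := rfl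

theorem apply_algebraMap_apply (f : ι → A) : M (M' (fun j ↦ algebraMap A _ (f j))) =
    M (fun j ↦ algebraMap A _ (reMap M' f j)) +
      (⟨0, 1⟩ : QuadraticAlgebra A 0 s) • M (fun j ↦ algebraMap A _ (imMap M' f j)) := by
  rw [← map_smul, ← map_add]
  congr 1
  ext i <;> simp [reMap_apply, imMap_apply]

variable {M M'}

theorem reMap_reMap_of_comp_eq_id (h : M ∘ₗ M' = LinearMap.id) (f : ι → A) :
    reMap M (reMap M' f) = f := by
  funext i
  have := congr(($(apply_algebraMap_apply M M' f) i).re)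
  rw [← LinearMap.comp_apply M M', h] at this
  simpa [reMap_apply] using this.symm

theorem imMap_reMap_of_comp_eq_id (h : M ∘ₗ M' = LinearMap.id) (f : ι → A) :
    imMap M (reMap M' f) + reMap M (imMap M' f) + s • imMap M (imMap M' f) = 0 := by
  funext i
  have := congr(($(apply_algebraMap_apply M M' f) i).im)
  rw [← LinearMap.comp_apply M M', h] at this
  simpa [reMap_apply, imMap_apply, ← add_assoc] using this.symm

end QuadraticParts

section Transvection

variable {A : Type*} [CommRing A] {s : A} {ι : Type*} {G : Type*} [AddCommGroup G] [Module A G]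
  (α : (ι → A) →ₗ[A] G) (β : G →ₗ[A] (ι → A))
  (M : (ι → QuadraticAlgebra A 0 s) ≃ₗ[QuadraticAlgebra A 0 s] (ι → QuadraticAlgebra A 0 s))

/-- The automorphism of `G` obtained from an automorphism of a free module over a quadratic
algebra, using the transfer maps `α` and `β`. -/
def transferEquiv (hβα : ∀ f, β (α f) = s • f) : G ≃ₗ[A] G :=
  LinearEquiv.ofLinearMap
    (LinearMap.id + α ∘ₗ imMap M.toLinearMap ∘ₗ reMap M.symm.toLinearMap ∘ₗ β)
    (LinearMap.id + α ∘ₗ reMap M.toLinearMap ∘ₗ imMap M.symm.toLinearMap ∘ₗ β)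
    (by
      have h₁ : M.toLinearMap ∘ₗ M.symm.toLinearMap = LinearMap.id := by ext1; simp
      have h₂ : M.symm.toLinearMap ∘ₗ M.toLinearMap = LinearMap.id := by ext1; simp
      refine LinearMap.ext fun g ↦ ?_
      have := congr(α $(imMap_reMap_of_comp_eq_id h₁ (β g)))
      simp only [map_add, map_smul, map_zero] at this
      simp only [LinearMap.comp_apply, LinearMap.add_apply, LinearMap.id_apply, map_add, hβα,
        map_smul, reMap_reMap_of_comp_eq_id h₂]
      rw [← sub_eq_zero, ← this]
      abel)
    (by
      have h₁ : M.toLinearMap ∘ₗ M.symm.toLinearMap = LinearMap.id := by ext1; simp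
      have h₂ : M.symm.toLinearMap ∘ₗ M.toLinearMap = LinearMap.id := by ext1; simp
      refine LinearMap.ext fun g ↦ ?_
      have := congr(α (reMap M.toLinearMap
        $(imMap_reMap_of_comp_eq_id h₂ (reMap M.symm.toLinearMap (β g)))))
      simp only [map_add, map_smul, map_zero, reMap_reMap_of_comp_eq_id h₁] at this
      simp only [LinearMap.comp_apply, LinearMap.add_apply, LinearMap.id_apply, map_add, hβα,
        map_smul]
      rw [← sub_eq_zero, ← this]
      abel)

theorem transferEquiv_apply (hβα : ∀ f, β (α f) = s • f) (g : G) : transferEquiv α β M hβα g =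
    g + α (imMap M.toLinearMap (reMap M.symm.toLinearMap (β g))) := rfl

theorem LinearMap.apply_mem_smul_top {M N : Type*} [AddCommGroup M] [Module A M] [AddCommGroup N]
    [Module A N] (f : M →ₗ[A] N) {I : Ideal A} {x : M} (hx : x ∈ I • (⊤ : Submodule A M)) :
    f x ∈ I • (⊤ : Submodule A N) :=
  Submodule.smul_top_le_comap_smul_top I f hx

theorem exists_linearEquiv_sub_mem (hβα : ∀ f, β (α f) = s • f) {I : Ideal A} {e v : ι → A}
    (hre : reMap M.toLinearMap e - e ∈ I • (⊤ : Submodule A (ι → A)))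
    (him : imMap M.toLinearMap e - v ∈ I • (⊤ : Submodule A (ι → A))) :
    ∃ Φ : G ≃ₗ[A] G, Φ (α e) - (α e + s • α v) ∈ I • (⊤ : Submodule A G) := by
  have h₂ : M.symm.toLinearMap ∘ₗ M.toLinearMap = LinearMap.id := by ext1; simp
  refine ⟨transferEquiv α β M hβα, ?_⟩
  have h₃ := (reMap M.symm.toLinearMap).apply_mem_smul_top hre
  rw [map_sub, reMap_reMap_of_comp_eq_id h₂] at h₃
  have h₄ := sub_mem him ((imMap M.toLinearMap).apply_mem_smul_top h₃)
  convert Submodule.smul_mem _ s (α.apply_mem_smul_top h₄) using 1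
  rw [transferEquiv_apply, hβα]
  simp only [map_smul, map_sub, smul_sub]
  abel

end Transvection

section QuadraticRow

open QuadraticAlgebra

theorem Ring.KrullDimLE.of_isIntegral {A B : Type*} [CommRing A] [CommRing B] {n : ℕ}
    [Ring.KrullDimLE n A] {f : A →+* B} (hf : f.IsIntegral) : Ring.KrullDimLE n B := by
  let : Algebra A B := f.toAlgebra
  have : Algebra.IsIntegral A B := ⟨hf⟩
  refine Ring.krullDimLE_iff.mpr (le_trans ?_ (Ring.krullDimLE_iff.mp ‹Ring.KrullDimLE n A›))
  refine Order.krullDim_le_of_strictMono (PrimeSpectrum.comap f) fun q q' h ↦ ?_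
  exact Ideal.IsIntegral.comap_lt_comap (R := A) (I := q.asIdeal) (J := q'.asIdeal) h

variable {A : Type*} [CommRing A] {s : A}

theorem re_mem_and_im_mem_of_mem_map {I : Ideal A} {x : QuadraticAlgebra A 0 s}
    (hx : x ∈ I.map (algebraMap A (QuadraticAlgebra A 0 s))) : x.re ∈ I ∧ x.im ∈ I := by
  induction hx using Submodule.span_induction with
  | mem x hx =>
    obtain ⟨a, ha, rfl⟩ := hx
    exact ⟨ha, I.zero_mem⟩
  | zero => exact ⟨I.zero_mem, I.zero_mem⟩
  | add x y _ _ hx hy => exact ⟨I.add_mem hx.1 hy.1, I.add_mem hx.2 hy.2⟩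
  | smul a x _ hx =>
    simp only [smul_eq_mul, re_mul, im_mul]
    exact ⟨I.add_mem (I.mul_mem_left _ hx.1) (I.mul_mem_left _ hx.2),
      I.add_mem (I.add_mem (I.mul_mem_left _ hx.2) (I.mul_mem_left _ hx.1))
        (I.mul_mem_left _ hx.2)⟩

variable {ι : Type*} [Fintype ι] [DecidableEq ι]

theorem span_range_mk_sup_eq_top {I : Ideal A} {v : ι → A} (i : ι)
    (ψ : (ι → A) →ₗ[A] A) (hψ : ψ (Pi.single i 1) + s * ψ v - 1 ∈ I) :
    Ideal.span (Set.range fun j ↦ (⟨(Pi.single i 1 : ι → A) j, v j⟩ : QuadraticAlgebra A 0 s)) ⊔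
      I.map (algebraMap A (QuadraticAlgebra A 0 s)) = ⊤ := by
  set w : ι → QuadraticAlgebra A 0 s := fun j ↦ ⟨(Pi.single i 1 : ι → A) j, v j⟩
  have hψ' (x : ι → A) : ψ x = ∑ j, x j * ψ (Pi.single j 1) := by
    conv_lhs => rw [pi_eq_sum_univ' x]
    rw [map_sum]
    simp only [map_smul, smul_eq_mul]
  have hq : (⟨ψ (Pi.single i 1), ψ v⟩ : QuadraticAlgebra A 0 s) ∈ Ideal.span (Set.range w) := by
    have : (⟨ψ (Pi.single i 1), ψ v⟩ : QuadraticAlgebra A 0 s) =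
        ∑ j, algebraMap A _ (ψ (Pi.single j 1)) * w j := by
      refine QuadraticAlgebra.ext ?_ ?_
      · rw [hψ', ← reₗ_apply, ← reₗ_apply, map_sum]
        simp [w, mul_comm]
      · rw [← imₗ_apply, ← imₗ_apply, map_sum]
        simpa [w, mul_comm] using hψ' v
    rw [this]
    exact sum_mem fun j _ ↦ Ideal.mul_mem_left _ _ (Ideal.subset_span ⟨j, rfl⟩)
  have hi := Ideal.mem_map_of_mem (algebraMap A (QuadraticAlgebra A 0 s)) hψ
  have hp : w i ∈ Ideal.span (Set.range w) := Ideal.subset_span ⟨i, rfl⟩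
  rw [Ideal.eq_top_iff_one]
  have : (1 : QuadraticAlgebra A 0 s) = (w i + ⟨ψ (Pi.single i 1), ψ v⟩ * (1 - w i)) +
      algebraMap A _ (ψ (Pi.single i 1) + s * ψ v - 1) * ⟨0, v i⟩ := by
    ext <;> simp [w]; ring
  rw [this]
  exact Submodule.add_mem_sup (add_mem hp (Ideal.mul_mem_right _ _ hq)) (Ideal.mul_mem_right _ _ hi)

theorem mem_smul_top_of_forall_mem {I : Ideal A} {x : ι → A} (hx : ∀ i, x i ∈ I) :
    x ∈ I • (⊤ : Submodule A (ι → A)) := by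
  rw [pi_eq_sum_univ' x]
  exact sum_mem fun i _ ↦ Submodule.smul_mem_smul (hx i) trivial

theorem exists_reMap_sub_mem_and_imMap_sub_mem (p : ℕ) [Fact p.Prime] (k : Type*) [Field k]
    [Algebra (ZMod p) k] [Algebra.IsIntegral (ZMod p) k] [IsAlgClosed k] [Algebra k A]
    [Algebra.FiniteType k A] {n : ℕ} (I : Ideal A) [Ring.KrullDimLE (n + 2) (A ⧸ I)]
    {v : Fin (n + 3) → A} (ψ : (Fin (n + 3) → A) →ₗ[A] A)
    (hψ : ψ (Pi.single 0 1) + s * ψ v - 1 ∈ I) :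
    ∃ M : (Fin (n + 3) → QuadraticAlgebra A 0 s) ≃ₗ[QuadraticAlgebra A 0 s]
        (Fin (n + 3) → QuadraticAlgebra A 0 s),
      reMap M.toLinearMap (Pi.single 0 1) - Pi.single 0 1 ∈
        I • (⊤ : Submodule A (Fin (n + 3) → A)) ∧
      imMap M.toLinearMap (Pi.single 0 1) - v ∈ I • (⊤ : Submodule A (Fin (n + 3) → A)) := by
  let R := QuadraticAlgebra A 0 s
  let w : Fin (n + 3) → R := fun j ↦ ⟨(Pi.single 0 1 : Fin (n + 3) → A) j, v j⟩
  have hw := span_range_mk_sup_eq_top (s := s) 0 ψ hψ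
  let J := I.map (algebraMap A R)
  let π := Ideal.Quotient.mk J
  have : Algebra.FiniteType k R := Algebra.FiniteType.trans (S := A) inferInstance inferInstance
  let f : A ⧸ I →+* R ⧸ J := Ideal.quotientMap J (algebraMap A R) Ideal.le_comap_map
  have hf : f.IsIntegral := fun x ↦ by
    obtain ⟨y, rfl⟩ := Ideal.Quotient.mk_surjective x
    have hy : (algebraMap A R).IsIntegralElem y := Algebra.IsIntegral.isIntegral y
    have := hy.map π
    exact RingHom.IsIntegralElem.of_comp (f := Ideal.Quotient.mk I) (g := f) this
  have : Ring.KrullDimLE (n + 2) (R ⧸ J) := Ring.KrullDimLE.of_isIntegral hf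
  have hspan : Ideal.span (Set.range (π ∘ w)) = ⊤ := by
    have := congr(Ideal.map π $hw)
    rw [Ideal.map_sup, Ideal.map_span, Ideal.map_top, ← Set.range_comp] at this
    rwa [Ideal.map_quotient_self, sup_bot_eq] at this
  have hE := Elem.of_krullDimLE p k n (R ⧸ J) (π ∘ w) hspan
  have he : (Pi.single 0 1 : Fin (n + 3) → R ⧸ J) = π ∘ Pi.single 0 1 := by
    funext i
    rw [Function.comp_apply, Pi.apply_single (fun _ ↦ π) (fun _ ↦ map_zero π), map_one]
  rw [he] at hE
  obtain ⟨w', hw', hπ⟩ := hE.symm.exists_lift π Ideal.Quotient.mk_surjective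
  obtain ⟨M, hM⟩ := hw'.exists_linearEquiv
  have hsub (i) : M (Pi.single 0 1) i - w i ∈ J := by
    rw [hM, ← Ideal.Quotient.mk_eq_mk_iff_sub_mem]
    exact congr($hπ i)
  have he' : (fun j ↦ algebraMap A R ((Pi.single 0 1 : Fin (n + 3) → A) j)) = Pi.single 0 1 := by
    funext i
    rw [Pi.apply_single (fun _ ↦ algebraMap A R) (fun _ ↦ map_zero _), map_one]
  refine ⟨M, mem_smul_top_of_forall_mem fun i ↦ ?_, mem_smul_top_of_forall_mem fun i ↦ ?_⟩
  · rw [Pi.sub_apply, reMap_apply, he']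
    exact (re_mem_and_im_mem_of_mem_map (hsub i)).1
  · rw [Pi.sub_apply, imMap_apply, he']
    exact (re_mem_and_im_mem_of_mem_map (hsub i)).2

end QuadraticRow

section Transitivity

variable {A : Type*} [CommRing A]

/-- Modulo `I`, every unimodular row `e₀ + Xv` over `A[X]/(X² - sX)`, with `e₀` the first unit
vector, is the first column of an invertible matrix. -/
def IsCompletableMod (r : ℕ) (s : A) (I : Ideal A) : Prop :=
  ∀ (v : Fin (r + 1) → A) (ψ : (Fin (r + 1) → A) →ₗ[A] A),
    ψ (Pi.single 0 1) + s * ψ v - 1 ∈ I →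
    ∃ M : (Fin (r + 1) → QuadraticAlgebra A 0 s) ≃ₗ[QuadraticAlgebra A 0 s]
        (Fin (r + 1) → QuadraticAlgebra A 0 s),
      reMap M.toLinearMap (Pi.single 0 1) - Pi.single 0 1 ∈
        I • (⊤ : Submodule A (Fin (r + 1) → A)) ∧
      imMap M.toLinearMap (Pi.single 0 1) - v ∈ I • (⊤ : Submodule A (Fin (r + 1) → A))

variable {r : ℕ} {s : A} {P : Type*} [AddCommGroup P] [Module A P]

theorem IsCompletableMod.exists_linearEquiv {I : Ideal A} (h : IsCompletableMod r s I)
    (hs : IsFreeUpTo r P s) {g : A × P} {φ : A × P →ₗ[A] A} (hφ : φ g = 1)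
    (hg : g - (1, 0) ∈ (I ⊔ Ideal.span {s ^ 2}) • (⊤ : Submodule A (A × P))) :
    ∃ Φ : (A × P) ≃ₗ[A] (A × P), Φ g - (1, 0) ∈ I • (⊤ : Submodule A (A × P)) := by
  obtain ⟨α, β, hαβ, hβα, hα⟩ := hs.exists_prod
  rw [Submodule.sup_smul, Submodule.ideal_span_singleton_smul] at hg
  obtain ⟨x, hx, y, hy, hxy⟩ := Submodule.mem_sup.mp hg
  obtain ⟨z, -, rfl⟩ := hy
  replace hxy : g - ((1, 0) + s • α (β z)) = x := by
    rw [hαβ, smul_smul, ← sq, ← sub_sub, ← hxy]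
    exact add_sub_cancel_right x _
  obtain ⟨M, hre, him⟩ := h (β z) (φ ∘ₗ α) (by
    have := neg_mem (φ.apply_mem_smul_top hx)
    rw [← hxy, map_sub, hφ, map_add, map_smul, neg_sub, Ideal.smul_top_eq_map] at this
    simpa [hα] using this)
  obtain ⟨Φ, hΦ⟩ := exists_linearEquiv_sub_mem α β M hβα hre him
  refine ⟨Φ.symm, ?_⟩
  rw [hα] at hΦ
  have := neg_mem (Φ.symm.toLinearMap.apply_mem_smul_top (sub_mem hΦ hx))
  rw [← hxy] at this
  simpa using this

theorem isCompletableMod_of_krullDimLE (p : ℕ) [Fact p.Prime] (k : Type*) [Field k]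
    [Algebra (ZMod p) k] [Algebra.IsIntegral (ZMod p) k] [IsAlgClosed k] [Algebra k A]
    [Algebra.FiniteType k A] {n : ℕ} (s : A) (I : Ideal A) [Ring.KrullDimLE (n + 2) (A ⧸ I)] :
    IsCompletableMod (n + 2) s I := fun _ ψ hψ ↦
  exists_reMap_sub_mem_and_imMap_sub_mem p k I ψ hψ

theorem exists_linearEquiv_apply_eq (p : ℕ) [Fact p.Prime] (k : Type*) [Field k]
    [Algebra (ZMod p) k] [Algebra.IsIntegral (ZMod p) k] [IsAlgClosed k] [Algebra k A]
    [Algebra.FiniteType k A] {n : ℕ} [Ring.KrullDimLE (n + 3) A] (hP : HasFreeCover A (n + 2) P)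
    (h : ∀ s : A, IsCompletableMod (n + 2) s ⊥)
    {g : A × P} {φ : A × P →ₗ[A] A} (hφ : φ g = 1) :
    ∃ Φ : (A × P) ≃ₗ[A] (A × P), Φ (1, 0) = g := by
  classical
  obtain ⟨⟨s, hs, hsq⟩, hspan⟩ := hP
  have main (T : Finset A) (hT : (T : Set A) ⊆ {t | IsFreeUpTo (n + 2) P t})
      (hΦ : ∃ Φ : (A × P) ≃ₗ[A] (A × P), Φ g - (1, 0) ∈
        (Ideal.span {s ^ 2} ⊔ Ideal.span ((· ^ 2) '' (T : Set A))) •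
          (⊤ : Submodule A (A × P))) :
      ∃ Φ : (A × P) ≃ₗ[A] (A × P), Φ g - (1, 0) ∈
        Ideal.span {s ^ 2} • (⊤ : Submodule A (A × P)) := by
    induction T using Finset.induction_on with
    | empty => simpa using hΦ
    | insert t T _ ih =>
      rw [Finset.coe_insert, Set.insert_subset_iff] at hT
      obtain ⟨Φ, hΦ⟩ := hΦ
      rw [Finset.coe_insert, Set.image_insert_eq, Ideal.span_insert, sup_left_comm,
        sup_comm] at hΦ
      let I := Ideal.span {s ^ 2} ⊔ Ideal.span ((· ^ 2) '' (T : Set A))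
      have : Ring.KrullDimLE (n + 2) (A ⧸ I) := Ring.KrullDimLE.quotient_of_not_le fun q hq hle ↦
        hsq q hq (hq.1.1.mem_of_pow_mem 2
          (hle (Ideal.mem_sup_left (Ideal.mem_span_singleton_self _))))
      obtain ⟨Φ', hΦ'⟩ := (isCompletableMod_of_krullDimLE p k t I).exists_linearEquiv hT.1
        (φ := φ ∘ₗ Φ.symm.toLinearMap) (g := Φ g) (by simpa using hφ) hΦ
      exact ih hT.2 ⟨Φ.trans Φ', hΦ'⟩
  obtain ⟨T, hT, hT'⟩ := (Ideal.span_eq_top_iff_finite _).mp hspan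
  obtain ⟨Φ, hΦ⟩ := main T hT ⟨LinearEquiv.refl A _, by
    simp [Ideal.span_pow_eq_top _ hT' 2]⟩
  obtain ⟨Φ', hΦ'⟩ := (h s).exists_linearEquiv hs (φ := φ ∘ₗ Φ.symm.toLinearMap) (g := Φ g)
    (by simpa using hφ) (by rwa [bot_sup_eq])
  rw [Submodule.bot_smul, Submodule.mem_bot, sub_eq_zero] at hΦ'
  refine ⟨(Φ.trans Φ').symm, ?_⟩
  rw [LinearEquiv.symm_apply_eq, ← hΦ']
  rfl

theorem isCompletableMod_bot
    (h : ∀ w : Fin (r + 1) → QuadraticAlgebra A 0 s, Ideal.span (Set.range w) = ⊤ →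
      ∃ M : (Fin (r + 1) → QuadraticAlgebra A 0 s) ≃ₗ[QuadraticAlgebra A 0 s]
        (Fin (r + 1) → QuadraticAlgebra A 0 s), M (Pi.single 0 1) = w) :
    IsCompletableMod r s ⊥ := fun v ψ hψ ↦ by
  have hspan := span_range_mk_sup_eq_top (s := s) 0 ψ hψ
  rw [Ideal.map_bot, sup_bot_eq] at hspan
  obtain ⟨M, hM⟩ := h _ hspan
  have he : (fun j ↦ algebraMap A (QuadraticAlgebra A 0 s)
      ((Pi.single 0 1 : Fin (r + 1) → A) j)) = Pi.single 0 1 := by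
    funext i
    rw [Pi.apply_single (fun _ ↦ algebraMap A (QuadraticAlgebra A 0 s)) (fun _ ↦ map_zero _), map_one]
  refine ⟨M, ?_, ?_⟩
  · convert Submodule.zero_mem _
    rw [sub_eq_zero]
    funext i
    rw [reMap_apply, he]
    exact congr(($hM i).re)
  · convert Submodule.zero_mem _
    rw [sub_eq_zero]
    funext i
    rw [imMap_apply, he]
    exact congr(($hM i).im)

end Transitivity

section Cancellation

/-- Splitting off the line spanned by an element on which a functional takes the value `1`. -/
def kerProdEquiv {R L : Type*} [CommRing R] [AddCommGroup L] [Module R L] (ψ : L →ₗ[R] R) {w : L}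
    (hw : ψ w = 1) : L ≃ₗ[R] R × LinearMap.ker ψ :=
  LinearEquiv.ofLinearMap
    (ψ.prod ((LinearMap.id - ψ.smulRight w).codRestrict (LinearMap.ker ψ) fun x ↦ by simp [hw]))
    ((LinearMap.toSpanSingleton R L w).coprod (LinearMap.ker ψ).subtype)
    (by
      refine LinearMap.ext fun x ↦ Prod.ext ?_ (Subtype.ext ?_) <;> simp [hw])
    (by
      refine LinearMap.ext fun x ↦ ?_
      simp)

theorem kerProdEquiv_self {R L : Type*} [CommRing R] [AddCommGroup L] [Module R L]
    (ψ : L →ₗ[R] R) {w : L} (hw : ψ w = 1) : kerProdEquiv ψ hw w = (1, 0) := by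
  refine Prod.ext hw (Subtype.ext ?_)
  change w - ψ w • w = 0
  rw [hw, one_smul, sub_self]

/-- `R ^ (r + 1)` as a product of its first coordinate and `R ^ r`. -/
def piSuccEquiv (R : Type*) [CommRing R] (r : ℕ) : (Fin (r + 1) → R) ≃ₗ[R] R × (Fin r → R) where
  toFun x := (x 0, Fin.tail x)
  invFun y := Fin.cons y.1 y.2
  map_add' _ _ := rfl
  map_smul' _ _ := rfl
  left_inv x := by simp
  right_inv y := by simp

theorem piSuccEquiv_apply {R : Type*} [CommRing R] {r : ℕ} (x : Fin (r + 1) → R) :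
    piSuccEquiv R r x = (x 0, Fin.tail x) := rfl

theorem IsCancellative.exists_linearEquiv {R : Type} [CommRing R] {r : ℕ}
    (hR : IsCancellative R (Fin r → R)) {w : Fin (r + 1) → R}
    (hw : Ideal.span (Set.range w) = ⊤) :
    ∃ M : (Fin (r + 1) → R) ≃ₗ[R] (Fin (r + 1) → R), M (Pi.single 0 1) = w := by
  obtain ⟨c, hc⟩ := Submodule.mem_span_range_iff_exists_fun R |>.mp
    ((Ideal.eq_top_iff_one _).mp hw)
  let ψ : (Fin (r + 1) → R) →ₗ[R] R := ∑ i, c i • LinearMap.proj i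
  have hψ : ψ w = 1 := by simpa [ψ] using hc
  let e := kerProdEquiv ψ hψ
  let Q := LinearMap.ker ψ
  have hsurj : Function.Surjective (LinearMap.snd R R Q ∘ₗ e.toLinearMap) :=
    Prod.snd_surjective.comp e.surjective
  have hfin : Module.Finite R Q := Module.Finite.of_surjective _ hsurj
  have hproj : Module.Projective R Q := Module.Projective.of_split
    (e.symm.toLinearMap ∘ₗ LinearMap.inr R R Q) (LinearMap.snd R R Q ∘ₗ e.toLinearMap)
    (by ext1 x; simp)
  let u : (Fin 1 → R) ≃ₗ[R] R := LinearEquiv.funUnique (Fin 1) R R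
  obtain ⟨f⟩ := hR Q hfin hproj 1
    ⟨(LinearEquiv.prodCongr (.refl R _) u).trans <| (LinearEquiv.prodComm R _ _).trans <|
      (piSuccEquiv R r).symm.trans <| e.trans <| (LinearEquiv.prodComm R _ _).trans <|
        (LinearEquiv.prodCongr (.refl R _) u.symm)⟩
  refine ⟨(piSuccEquiv R r).trans <| (LinearEquiv.prodCongr (.refl R R) f).trans e.symm, ?_⟩
  have htail : piSuccEquiv R r (Pi.single 0 1) = (1, 0) := by
    have : Fin.tail (Pi.single 0 1 : Fin (r + 1) → R) = 0 := by
      funext i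
      simp [Fin.tail]
    rw [piSuccEquiv_apply, this, Pi.single_eq_same]
  rw [LinearEquiv.trans_apply, LinearEquiv.trans_apply, htail, LinearEquiv.symm_apply_eq,
    kerProdEquiv_self ψ hψ]
  simp

variable {A : Type*} [CommRing A] {P Q : Type*} [AddCommGroup P] [Module A P] [AddCommGroup Q]
  [Module A Q]

theorem symm_apply_snd_apply_snd (f : (A × P) ≃ₗ[A] (A × Q)) (hf : f (1, 0) = (1, 0)) (x : P) :
    (f.symm (0, (f (0, x)).2)).2 = x := by
  have : ((0, (f (0, x)).2) : A × Q) = f (0, x) - (f (0, x)).1 • (1, 0) := by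
    ext <;> simp
  rw [this, map_sub, map_smul, f.symm_apply_eq.mpr hf.symm]
  simp

theorem nonempty_linearEquiv_of_apply_eq (f : (A × P) ≃ₗ[A] (A × Q)) (hf : f (1, 0) = (1, 0)) :
    Nonempty (P ≃ₗ[A] Q) :=
  ⟨LinearEquiv.ofLinearMap
    (LinearMap.snd A A Q ∘ₗ f.toLinearMap ∘ₗ LinearMap.inr A A P)
    (LinearMap.snd A A P ∘ₗ f.symm.toLinearMap ∘ₗ LinearMap.inr A A Q)
    (LinearMap.ext fun x ↦
      symm_apply_snd_apply_snd f.symm (f.symm_apply_eq.mpr hf.symm) x)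
    (LinearMap.ext fun x ↦ symm_apply_snd_apply_snd f hf x)⟩

/-- `P × A ^ (m + 1)` as a product of `A` and `P × A ^ m`. -/
def prodPiSuccEquiv (A : Type*) [CommRing A] (P : Type*) [AddCommGroup P] [Module A P] (m : ℕ) :
    (P × (Fin (m + 1) → A)) ≃ₗ[A] A × (P × (Fin m → A)) where
  toFun x := (x.2 0, x.1, Fin.tail x.2)
  invFun y := (y.2.1, Fin.cons y.1 y.2.2)
  map_add' _ _ := rfl
  map_smul' _ _ := rfl
  left_inv x := by simp
  right_inv y := by simp

theorem HasFreeCover.prod_pi {r : ℕ} (h : HasFreeCover A r P) (m : ℕ) :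
    HasFreeCover A (r + m) (P × (Fin m → A)) := by
  induction m with
  | zero => exact h.congr LinearEquiv.prodUnique.symm
  | succ m ih => exact ih.prod.congr (prodPiSuccEquiv A P m).symm

end Cancellation

theorem statement4
    (p : ℕ) [Fact p.Prime]
    (A : Type) [CommRing A] [Algebra (AlgebraicClosure (ZMod p)) A]
    [Algebra.FiniteType (AlgebraicClosure (ZMod p)) A]
    (d : ℕ) (hd : 4 ≤ d) (hdim : ringKrullDim A = d)
    -- for every finite ring extension `R` of `A`, `R ^ (d - 1)` is cancellative
    (hext : ∀ (R : Type) [CommRing R] [Algebra A R],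
      Function.Injective (algebraMap A R) → Module.Finite A R →
        IsCancellative R (Fin (d - 1) → R))
    (P : Type) [AddCommGroup P] [Module A P] [Module.Finite A P] [Module.Projective A P]
    (hrank : HasRank A P (d - 1)) :
    IsCancellative A P := by
  obtain ⟨n, rfl⟩ : ∃ n, d = n + 3 := ⟨d - 3, by lia⟩
  rw [show n + 3 - 1 = n + 2 by lia] at hext hrank
  have : IsNoetherianRing A :=
    Algebra.FiniteType.isNoetherianRing (AlgebraicClosure (ZMod p)) A
  have hP : HasFreeCover A (n + 2) P := hasFreeCover_of_rankAtStalk hrank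
  have hA (m : ℕ) : Ring.KrullDimLE (n + 3 + m) A := by
    rw [Ring.krullDimLE_iff, hdim]
    exact_mod_cast Nat.le_add_right _ m
  have hcomp (m : ℕ) (s : A) : IsCompletableMod (n + m + 2) s ⊥ := by
    cases m with
    | zero =>
      exact isCompletableMod_bot fun w hw ↦ IsCancellative.exists_linearEquiv
        (hext _ QuadraticAlgebra.algebraMap_injective inferInstance) hw
    | succ m =>
      have : Ring.KrullDimLE (n + (m + 1) + 2) A := by
        have := hA m
        rwa [show n + (m + 1) + 2 = n + 3 + m by lia]
      have : Ring.KrullDimLE (n + (m + 1) + 2) (A ⧸ (⊥ : Ideal A)) := Ring.KrullDimLE.quotient ⊥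
      exact isCompletableMod_of_krullDimLE p (AlgebraicClosure (ZMod p)) s ⊥
  intro Q _ _ _ _ m ⟨e⟩
  induction m with
  | zero => exact ⟨LinearEquiv.prodUnique.symm.trans <| e.trans LinearEquiv.prodUnique⟩
  | succ m ih =>
    let f : (A × (P × (Fin m → A))) ≃ₗ[A] (A × (Q × (Fin m → A))) :=
      (prodPiSuccEquiv A P m).symm.trans <| e.trans <| prodPiSuccEquiv A Q m
    have hcover : HasFreeCover A (n + m + 2) (P × (Fin m → A)) := by
      rw [add_right_comm]
      exact hP.prod_pi m
    have : Ring.KrullDimLE (n + m + 3) A := by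
      rw [add_right_comm]
      exact hA m
    obtain ⟨Φ, hΦ⟩ := exists_linearEquiv_apply_eq p (AlgebraicClosure (ZMod p)) hcover (hcomp m)
      (g := f.symm (1, 0)) (φ := LinearMap.fst A A _ ∘ₗ f.toLinearMap) (by simp)
    obtain ⟨e'⟩ := nonempty_linearEquiv_of_apply_eq (Φ.trans f) (by simp [hΦ])
    exact ih e'
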